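/- Let ĝ be a simple Lie algebra with Coxeter number h. A nilpotent element N ∈ ĝ satisfies ad(N)^{2h−2} ≠ 0 if and only if N is regular nilpotent. Equivalently, the regular nilpotent class is the unique nilpotent class whose action on ĝ under the adjoint representation has a Jordan block of size ≥ 2h−1. -/

import Mathlib

namespace LieAlgebra

open Module

section Projection

variable {K V : Type*} [Field K] [IsAlgClosed K] [AddCommGroup V] [Module K V]
  [FiniteDimensional K V]

open Classical in
lemma isInternal_maxGenEigenspace (A : End K V) :
    Function.Bijective (DirectSum.coeLinearMap fun μ ↦ A.maxGenEigenspace μ) :=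
  (DirectSum.isInternal_submodule_iff_iSupIndep_and_iSup_eq_top _).2
    ⟨A.independent_maxGenEigenspace, A.iSup_maxGenEigenspace_eq_top⟩

open Classical in
/-- The projection onto a generalized eigenspace along the other generalized eigenspaces. -/
noncomputable def genProj (A : End K V) (μ : K) : End K V :=
  (A.maxGenEigenspace μ).subtype ∘ₗ DirectSum.component K K (fun ν ↦ A.maxGenEigenspace ν) μ ∘ₗ
    (LinearEquiv.ofBijective (DirectSum.coeLinearMap fun ν ↦ A.maxGenEigenspace ν)
      (isInternal_maxGenEigenspace A)).symm.toLinearMap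

variable {A : End K V} {μ ν : K} {x : V}

lemma genProj_mem (A : End K V) (μ : K) (x : V) : genProj A μ x ∈ A.maxGenEigenspace μ := by
  simp [genProj]

open Classical in
lemma genProj_eq_ite (hx : x ∈ A.maxGenEigenspace ν) :
    genProj A μ x = if μ = ν then x else 0 := by
  have : (LinearEquiv.ofBijective (DirectSum.coeLinearMap fun ν ↦ A.maxGenEigenspace ν)
      (isInternal_maxGenEigenspace A)).symm x = DirectSum.lof K K _ ν ⟨x, hx⟩ := by
    rw [LinearEquiv.symm_apply_eq]
    simp
  simp only [genProj, LinearMap.comp_apply, LinearEquiv.coe_coe, this]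
  split_ifs with h
  · subst h
    simp [DirectSum.component.lof_self]
  · rw [DirectSum.component.of, dif_neg (Ne.symm h)]
    simp

lemma genProj_of_mem (hx : x ∈ A.maxGenEigenspace μ) : genProj A μ x = x := by
  simp [genProj_eq_ite hx]

lemma genProj_of_mem_of_ne (hx : x ∈ A.maxGenEigenspace ν) (h : μ ≠ ν) : genProj A μ x = 0 := by
  simp [genProj_eq_ite hx, h]

lemma eq_zero_of_forall_genProj_eq_zero (A : End K V) (h : ∀ μ, genProj A μ x = 0) : x = 0 := by
  classical
  have : (LinearEquiv.ofBijective (DirectSum.coeLinearMap fun ν ↦ A.maxGenEigenspace ν)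
      (isInternal_maxGenEigenspace A)).symm x = 0 := by
    refine DirectSum.ext_component K fun μ ↦ ?_
    have := h μ
    simpa [genProj] using this
  simpa using this

lemma maxGenEigenspace_induction (A : End K V) {p : V → Prop} (x : V)
    (mem : ∀ μ, ∀ x ∈ A.maxGenEigenspace μ, p x) (add : ∀ x y, p x → p y → p (x + y)) : p x := by
  have hx : x ∈ ⨆ μ, A.maxGenEigenspace μ := by simp [A.iSup_maxGenEigenspace_eq_top]
  exact Submodule.iSup_induction _ (motive := p) hx mem (mem 0 0 (zero_mem _)) add

lemma exists_sum_genProj_eq (A : End K V) (x : V) : ∃ S : Finset K, ∑ μ ∈ S, genProj A μ x = x := by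
  classical
  suffices ∃ S : Finset K, ∀ T, S ⊆ T → ∑ μ ∈ T, genProj A μ x = x by
    obtain ⟨S, hS⟩ := this
    exact ⟨S, hS S subset_rfl⟩
  refine maxGenEigenspace_induction (p := fun x ↦ ∃ S : Finset K, ∀ T, S ⊆ T →
    ∑ μ ∈ T, genProj A μ x = x) A x (fun ν x hx ↦ ⟨{ν}, fun T hT ↦ ?_⟩) ?_
  · simp only [genProj_eq_ite hx, Finset.sum_ite_eq', ite_eq_left_iff]
    exact fun h ↦ absurd (hT (Finset.mem_singleton_self ν)) h
  · rintro x y ⟨S, hS⟩ ⟨S', hS'⟩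
    refine ⟨S ∪ S', fun T hT ↦ ?_⟩
    simp only [map_add, Finset.sum_add_distrib]
    rw [hS T (Finset.union_subset_left hT), hS' T (Finset.union_subset_right hT)]

lemma linearMap_ext_maxGenEigenspace {W : Type*} [AddCommGroup W] [Module K W] (A : End K V)
    {f g : V →ₗ[K] W} (h : ∀ μ, ∀ x ∈ A.maxGenEigenspace μ, f x = g x) : f = g := by
  ext x
  exact maxGenEigenspace_induction (p := fun x ↦ f x = g x) A x h fun x y hx hy ↦ by simp [hx, hy]

lemma genProj_apply_of_shift {T : End K V} {c : K}
    (hT : ∀ μ, ∀ x ∈ A.maxGenEigenspace μ, T x ∈ A.maxGenEigenspace (μ + c)) (μ : K) (x : V) :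
    genProj A (μ + c) (T x) = T (genProj A μ x) := by
  refine maxGenEigenspace_induction (p := fun x ↦ genProj A (μ + c) (T x) = T (genProj A μ x)) A x
    (fun ν x hx ↦ ?_) fun x y hx hy ↦ by simp [hx, hy]
  classical
  rw [genProj_eq_ite (hT ν x hx), genProj_eq_ite hx]
  split_ifs <;> simp_all

lemma maxGenEigenspace_eq_bot_of_trace_eq_zero [CharZero K]
    (h : LinearMap.trace K V (A * genProj A μ) = 0) (hμ : μ ≠ 0) :
    A.maxGenEigenspace μ = ⊥ := by
  have h1 : LinearMap.IsProj (A.maxGenEigenspace μ) (genProj A μ) :=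
    ⟨genProj_mem A μ, fun x hx ↦ genProj_of_mem hx⟩
  have hc : Commute (A - μ • 1) (genProj A μ) := by
    ext x
    have := genProj_apply_of_shift (A := A) (T := A - μ • 1) (c := 0)
      (fun ν y hy ↦ by
        rw [add_zero]
        exact A.mapsTo_maxGenEigenspace_of_comm
          ((Commute.refl A).sub_right ((Commute.one_right A).smul_right μ)) ν hy) μ x
    rw [add_zero] at this
    exact this.symm
  have h2 : IsNilpotent (A * genProj A μ - μ • genProj A μ) := by
    refine ⟨finrank K V + 1, ?_⟩
    have : A * genProj A μ - μ • genProj A μ = (A - μ • 1) * genProj A μ := by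
      rw [sub_mul, smul_mul_assoc, one_mul]
    rw [this, hc.mul_pow, pow_succ' (genProj A μ), pow_succ']
    ext x
    have hx := genProj_mem A μ ((genProj A μ ^ finrank K V) x)
    rw [Module.End.maxGenEigenspace_eq_genEigenspace_finrank,
      Module.End.mem_genEigenspace_nat] at hx
    simp only [Module.End.mul_apply, LinearMap.zero_apply]
    rw [LinearMap.mem_ker.1 hx, map_zero]
  have h3 := (LinearMap.isNilpotent_trace_of_isNilpotent h2).eq_zero
  rw [map_sub, h, map_smul, h1.trace] at h3
  have h4 : finrank K (A.maxGenEigenspace μ) = 0 := by simpa [hμ] using h3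
  exact Submodule.finrank_eq_zero.1 h4

end Projection

section Grade

variable {K g : Type*} [Field K] [LieRing g] [LieAlgebra K g]

variable (K) in
/-- The generalized eigenspaces of `ad a`, which form a grading of the Lie algebra. -/
abbrev grade (a : g) (μ : K) : Submodule K g := (ad K g a).maxGenEigenspace μ

lemma lie_mem_grade {a x y : g} {μ ν : K} (hx : x ∈ grade K a μ) (hy : y ∈ grade K a ν) :
    ⁅x, y⁆ ∈ grade K a (μ + ν) :=
  LieModule.lie_mem_maxGenEigenspace_toEnd (R := K) (L := g) (M := g) hx hy

lemma mem_grade_of_lie_eq {a x : g} {μ : K} (h : ⁅a, x⁆ = μ • x) : x ∈ grade K a μ :=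
  Module.End.mem_maxGenEigenspace _ _ _ |>.2 ⟨1, by simp [h]⟩

lemma self_mem_grade_zero (a : g) : a ∈ grade K a 0 := mem_grade_of_lie_eq (by simp)

variable [IsAlgClosed K] [FiniteDimensional K g]

lemma genProj_lie {a x : g} {μ ν : K} (hx : x ∈ grade K a ν) (y : g) :
    genProj (ad K g a) (μ + ν) ⁅x, y⁆ = ⁅x, genProj (ad K g a) μ y⁆ :=
  genProj_apply_of_shift (T := ad K g x) (c := ν)
    (fun μ y hy ↦ by rw [add_comm]; exact lie_mem_grade hx hy) μ y

lemma killingForm_eq_zero_of_mem_grade {a x y : g} {μ ν : K} (h : μ + ν ≠ 0)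
    (hx : x ∈ grade K a μ) (hy : y ∈ grade K a ν) : killingForm K g x y = 0 := by
  classical
  rw [killingForm_apply_apply]
  refine LinearMap.trace_eq_zero_of_mapsTo_ne (isInternal_maxGenEigenspace (ad K g a))
    (fun χ ↦ (μ + ν) + χ) (fun χ ↦ by simpa using h) fun χ z hz ↦ ?_
  simp only [LinearMap.comp_apply, ad_apply]
  rw [add_assoc]
  exact lie_mem_grade hx (lie_mem_grade hy hz)

lemma killingForm_genProj {a y : g} {μ : K} (x : g) (hy : y ∈ grade K a μ) :
    killingForm K g (genProj (ad K g a) (-μ) x) y = killingForm K g x y := by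
  classical
  refine maxGenEigenspace_induction (p := fun x ↦
    killingForm K g (genProj (ad K g a) (-μ) x) y = killingForm K g x y) (ad K g a) x
    (fun ν x hx ↦ ?_) fun x z hx hz ↦ by simp [hx, hz]
  rw [genProj_eq_ite hx]
  split_ifs with h
  · rfl
  · rw [map_zero, LinearMap.zero_apply, killingForm_eq_zero_of_mem_grade ?_ hx hy]
    contrapose! h
    exact (eq_neg_of_add_eq_zero_left h).symm

lemma killingForm_eq_zero_of_genProj {a x y : g}
    (h : ∀ μ, genProj (ad K g a) (-μ) x = 0 ∨ genProj (ad K g a) μ y = 0) :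
    killingForm K g x y = 0 := by
  obtain ⟨S, hS⟩ := exists_sum_genProj_eq (ad K g a) y
  rw [← hS, map_sum]
  refine Finset.sum_eq_zero fun μ _ ↦ ?_
  rcases h μ with h | h
  · rw [← killingForm_genProj x (genProj_mem _ μ y), h, map_zero, LinearMap.zero_apply]
  · rw [h, map_zero]

variable [IsKilling K g]

lemma eq_zero_of_mem_grade {a x : g} {μ : K} (hx : x ∈ grade K a μ)
    (h : ∀ y ∈ grade K a (-μ), killingForm K g x y = 0) : x = 0 := by
  refine (IsKilling.killingForm_nondegenerate K g).1 x fun y ↦ ?_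
  refine maxGenEigenspace_induction (p := fun y ↦ killingForm K g x y = 0) (ad K g a) y
    (fun ν y hy ↦ ?_)
    fun y z hy hz ↦ by simp [hy, hz]
  by_cases hν : μ + ν = 0
  · exact h y (by rwa [← eq_neg_of_add_eq_zero_right hν])
  · exact killingForm_eq_zero_of_mem_grade hν hx hy

lemma grade_neg_ne_bot {a : g} {μ : K} (h : grade K a μ ≠ ⊥) : grade K a (-μ) ≠ ⊥ := by
  contrapose! h
  refine (Submodule.eq_bot_iff _).2 fun x hx ↦ eq_zero_of_mem_grade hx fun y hy ↦ ?_
  rw [h, Submodule.mem_bot] at hy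
  simp [hy]

end Grade

lemma mem_range_ad_pow_of_killingForm_eq_zero {K g : Type*} [Field K] [LieRing g] [LieAlgebra K g]
    [FiniteDimensional K g] [IsKilling K g] {x y : g} (n : ℕ)
    (h : ∀ w, (ad K g x ^ n) w = 0 → killingForm K g y w = 0) :
    y ∈ LinearMap.range (ad K g x ^ n) := by
  by_contra hy
  obtain ⟨f, hfy, hf⟩ := Submodule.exists_dual_map_eq_bot_of_notMem hy inferInstance
  have hnd := IsKilling.killingForm_nondegenerate K g
  obtain ⟨w, rfl⟩ : ∃ w, killingForm K g w = f :=
    ⟨(LinearMap.BilinForm.toDual _ hnd).symm f, by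
      ext z; exact LinearMap.BilinForm.apply_toDual_symm_apply ..⟩
  refine hfy ?_
  rw [LieModule.traceForm_comm]
  refine h w ?_
  have key : ∀ n : ℕ, ∀ w z : g, killingForm K g ((ad K g x ^ n) w) z =
      (-1) ^ n * killingForm K g w ((ad K g x ^ n) z) := by
    intro n
    induction n with
    | zero => simp
    | succ n ih =>
      intro w z
      have hz : (ad K g x ^ (n + 1)) z = (ad K g x ^ n) (ad K g x z) := by
        rw [pow_succ, Module.End.mul_apply]
      rw [hz, pow_succ' (ad K g x), Module.End.mul_apply, ad_apply, ← lie_skew, map_neg,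
        LinearMap.neg_apply, LieModule.traceForm_apply_lie_apply, ← ad_apply K]
      change -killingForm K g ((ad K g x ^ n) w) _ = _
      rw [ih, pow_succ]
      ring
  refine hnd.1 _ fun z ↦ ?_
  have : killingForm K g w ((ad K g x ^ n) z) ∈ (⊥ : Submodule K K) :=
    hf ▸ Submodule.mem_map_of_mem (LinearMap.mem_range_self _ z)
  rw [key, (Submodule.mem_bot K).1 this, mul_zero]

lemma mem_range_ad_of_killingForm_eq_zero {K g : Type*} [Field K] [LieRing g] [LieAlgebra K g]
    [FiniteDimensional K g] [IsKilling K g] {x y : g}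
    (h : ∀ w, ⁅x, w⁆ = 0 → killingForm K g y w = 0) : y ∈ LinearMap.range (ad K g x) := by
  simpa using mem_range_ad_pow_of_killingForm_eq_zero 1 (by simpa using h)

end LieAlgebra

namespace LieAlgebra

open Module

section Ring

variable {R : Type*} [Ring R] {E Y H : R}

lemma pow_succ_mul_sub_mul_pow_succ (h₁ : E * Y - Y * E = H) (h₂ : H * E - E * H = 2 * E) (n : ℕ) :
    E ^ (n + 1) * Y - Y * E ^ (n + 1) = (n + 1) * (H - n) * E ^ n := by
  induction n with
  | zero => simpa using h₁
  | succ n ih =>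
    have key : E ^ (n + 2) * Y - Y * E ^ (n + 2)
        = E * (E ^ (n + 1) * Y - Y * E ^ (n + 1)) + (E * Y - Y * E) * E ^ (n + 1) := by
      rw [pow_succ' E (n + 1)]; noncomm_ring
    have hc : Commute (n : R) E := Nat.cast_commute n E
    have hE : E * ((n + 1) * (H - n)) = ((n + 1) * (H - 2 - n)) * E := by
      have h₂' : E * H = H * E - 2 * E := by rw [← h₂]; abel
      have : E * ((n + 1) * (H - n)) = (n + 1) * (E * H - n * E) := by
        rw [← mul_assoc, ((hc.add_left (Commute.one_left E)).symm).eq, mul_assoc, mul_sub,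
          hc.symm.eq]
      rw [this, h₂', mul_assoc]
      noncomm_ring
    rw [key, ih, h₁, ← mul_assoc, hE, mul_assoc, ← pow_succ']
    push_cast
    noncomm_ring

end Ring

variable {K g : Type*} [Field K] [LieRing g] [LieAlgebra K g]

/-- `y` and `a` complete the ad-nilpotent element `N` to the relations of an `sl₂`-triple not
involving `⁅a, y⁆`. -/
structure IsHalfTriple (K : Type*) {g : Type*} [Field K] [LieRing g] [LieAlgebra K g]
    (N y a : g) : Prop where
  isNilpotent : IsNilpotent (ad K g N)
  lie_eq : ⁅N, y⁆ = a
  lie_self : ⁅a, N⁆ = (2 : K) • N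

namespace IsHalfTriple

variable {N y a : g} (t : IsHalfTriple K N y a)
include t

lemma mem_grade : N ∈ grade K a 2 := mem_grade_of_lie_eq t.lie_self

lemma ad_mul_sub : ad K g N * ad K g y - ad K g y * ad K g N = ad K g a := by
  rw [← t.lie_eq]
  ext x
  simp

lemma ad_mul_sub' : ad K g a * ad K g N - ad K g N * ad K g a = 2 * ad K g N := by
  have : ad K g ⁅a, N⁆ = ad K g a * ad K g N - ad K g N * ad K g a := by
    ext x
    simp
  rw [← this, t.lie_self]
  ext; simp [two_mul, two_smul]

lemma pow_mem_grade {μ : K} {x : g} (hx : x ∈ grade K a μ) (n : ℕ) :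
    (ad K g N ^ n) x ∈ grade K a (μ + 2 * n) := by
  induction n with
  | zero => simpa using hx
  | succ n ih =>
    have := lie_mem_grade t.mem_grade ih
    rw [pow_succ', Module.End.mul_apply, ad_apply]
    convert this using 1
    push_cast; ring_nf

lemma exists_pow_ne_zero_and {v : g} (hv0 : v ≠ 0) :
    ∃ k, (ad K g N ^ k) v ≠ 0 ∧ ⁅N, (ad K g N ^ k) v⁆ = 0 := by
  classical
  have hex : ∃ k, (ad K g N ^ k) v = 0 := by
    obtain ⟨k, hk⟩ := t.isNilpotent
    exact ⟨k, by simp [hk]⟩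
  obtain ⟨k, hk⟩ : ∃ k, Nat.find hex = k + 1 := by
    refine Nat.exists_eq_succ_of_ne_zero fun h0 ↦ ?_
    have := Nat.find_spec hex
    simp [h0, hv0] at this
  have h1 : (ad K g N ^ (k + 1)) v = 0 := hk ▸ Nat.find_spec hex
  rw [pow_succ'] at h1
  exact ⟨k, Nat.find_min hex (by omega), h1⟩

variable [CharZero K]

lemma eq_natCast_of_lie_eq {v : g} {μ : K} (hv : ⁅N, v⁆ = 0) (hv0 : v ≠ 0) (hμ : ⁅a, v⁆ = μ • v) :
    ∃ n : ℕ, μ = n ∧ ad K g N ^ n ≠ 0 := by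
  classical
  obtain ⟨m, hm⟩ := t.isNilpotent
  have hex : ∃ n, v ∉ LinearMap.range (ad K g N ^ n) := ⟨m, by simpa [hm] using hv0⟩
  obtain ⟨n, hn⟩ : ∃ n, Nat.find hex = n + 1 := by
    refine Nat.exists_eq_succ_of_ne_zero fun h0 ↦ ?_
    have := Nat.find_spec hex
    rw [h0] at this
    simp at this
  have h1 : v ∉ LinearMap.range (ad K g N ^ (n + 1)) := hn ▸ Nat.find_spec hex
  obtain ⟨w, hw⟩ : v ∈ LinearMap.range (ad K g N ^ n) := by
    by_contra h; exact Nat.find_min hex (by omega) h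
  refine ⟨n, ?_, fun h ↦ hv0 (by simp [← hw, h])⟩
  by_contra hne
  have key := congrArg (fun T : End K g ↦ T w)
    (pow_succ_mul_sub_mul_pow_succ t.ad_mul_sub t.ad_mul_sub' n)
  have e1 : (ad K g N ^ (n + 1)) w = 0 := by simp [pow_succ', hw, hv]
  have e2 : ((n : End K g) + 1) = algebraMap K (End K g) ((n : K) + 1) := by simp
  have e3 : (n : End K g) = algebraMap K (End K g) n := by simp
  rw [e2, e3] at key
  simp only [LinearMap.sub_apply, Module.End.mul_apply, e1, map_zero, sub_zero, hw,
    Module.algebraMap_end_apply, ad_apply, hμ] at key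
  rw [← sub_smul, smul_smul] at key
  have hc : ((n : K) + 1) * (μ - n) ≠ 0 :=
    mul_ne_zero (by exact_mod_cast n.succ_ne_zero) (sub_ne_zero.2 hne)
  refine h1 ⟨(((n : K) + 1) * (μ - n))⁻¹ • ⁅y, w⁆, ?_⟩
  rw [map_smul, key, smul_smul, inv_mul_cancel₀ hc, one_smul]

lemma eq_natCast_of_mem_grade {v : g} {μ : K} (hv : ⁅N, v⁆ = 0) (hv0 : v ≠ 0)
    (hμ : v ∈ grade K a μ) : ∃ n : ℕ, μ = n ∧ ad K g N ^ n ≠ 0 := by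
  classical
  set T : End K g := ad K g a - algebraMap K _ μ
  have hex : ∃ k, (T ^ k) v = 0 := by
    obtain ⟨k, hk⟩ := (Module.End.mem_maxGenEigenspace _ _ _).1 hμ
    exact ⟨k, by simpa [T, Module.algebraMap_end_eq_smul_id, ← Module.End.one_eq_id] using hk⟩
  obtain ⟨k, hk⟩ : ∃ k, Nat.find hex = k + 1 := by
    refine Nat.exists_eq_succ_of_ne_zero fun h0 ↦ ?_
    have := Nat.find_spec hex
    simp [h0, hv0] at this
  have h1 : (T ^ (k + 1)) v = 0 := hk ▸ Nat.find_spec hex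
  have h2 : (T ^ k) v ≠ 0 := Nat.find_min hex (by omega)
  have h3 : ∀ j, ⁅N, (T ^ j) v⁆ = 0 := fun j ↦ by
    induction j with
    | zero => simpa using hv
    | succ j ih =>
      rw [pow_succ', Module.End.mul_apply]
      simp only [T, LinearMap.sub_apply, ad_apply, Module.algebraMap_end_apply, lie_sub, lie_smul,
        ih]
      rw [leibniz_lie, ih, ← lie_skew N a, t.lie_self]
      simp [T, ih]
  refine t.eq_natCast_of_lie_eq (h3 k) h2 ?_
  rw [pow_succ', Module.End.mul_apply] at h1
  simpa [T, sub_eq_zero] using h1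

lemma exists_natCast_eq_add {v : g} {μ : K} (hv0 : v ≠ 0) (hμ : v ∈ grade K a μ) :
    ∃ k n : ℕ, μ + 2 * k = n ∧ ad K g N ^ n ≠ 0 := by
  obtain ⟨k, hk, hk'⟩ := t.exists_pow_ne_zero_and hv0
  exact ⟨k, t.eq_natCast_of_mem_grade hk' hk (t.pow_mem_grade hμ k)⟩

lemma exists_intCast_of_grade_ne_bot {μ : K} (h : grade K a μ ≠ ⊥) : ∃ m : ℤ, μ = m := by
  obtain ⟨v, hv, hv0⟩ := Submodule.exists_mem_ne_zero_of_ne_bot h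
  obtain ⟨k, n, h, -⟩ := t.exists_natCast_eq_add hv0 hv
  exact ⟨n - 2 * k, by push_cast; linear_combination h⟩

lemma pow_ne_zero_of_grade_ne_bot {n k : ℕ} (hk : k ≤ n) (h : grade K a (n : K) ≠ ⊥) :
    ad K g N ^ k ≠ 0 := by
  obtain ⟨v, hv, hv0⟩ := Submodule.exists_mem_ne_zero_of_ne_bot h
  obtain ⟨j, m, h, hm⟩ := t.exists_natCast_eq_add hv0 hv
  have : n + 2 * j = m := by exact_mod_cast h
  exact fun h0 ↦ hm (pow_eq_zero_of_le (by omega) h0)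

lemma eq_zero_of_lie_eq_zero_of_mem_grade {x : g} {m : ℤ} (hm : m < 0) (hx : x ∈ grade K a (m : K))
    (h : ⁅N, x⁆ = 0) : x = 0 := by
  by_contra h0
  obtain ⟨n, hn, -⟩ := t.eq_natCast_of_mem_grade h h0 hx
  have : m = n := by exact_mod_cast hn
  omega

variable [IsAlgClosed K] [FiniteDimensional K g]

lemma exists_intCast_of_genProj_ne_zero {μ : K} {x : g} (h : genProj (ad K g a) μ x ≠ 0) :
    ∃ m : ℤ, μ = m :=
  t.exists_intCast_of_grade_ne_bot fun h0 ↦ h <| by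
    simpa [h0] using genProj_mem (ad K g a) μ x

variable [IsKilling K g]

lemma exists_grade_ne_bot_of_pow_ne_zero {k : ℕ} (h : ad K g N ^ k ≠ 0) :
    ∃ n : ℕ, k ≤ n ∧ grade K a (n : K) ≠ ⊥ := by
  by_contra! hc
  refine h (linearMap_ext_maxGenEigenspace (ad K g a) fun μ x hx ↦ ?_)
  simp only [LinearMap.zero_apply]
  by_contra h0
  have hx0 : x ≠ 0 := by rintro rfl; simp at h0
  have h1 : grade K a μ ≠ ⊥ := fun hb ↦ hx0 (by simpa [hb] using (show x ∈ grade K a μ from hx))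
  have h2 : grade K a (μ + 2 * k) ≠ ⊥ := fun hb ↦ h0 (by simpa [hb] using t.pow_mem_grade hx k)
  obtain ⟨m, rfl⟩ := t.exists_intCast_of_grade_ne_bot h1
  rcases le_total 0 (m + k) with hm | hm
  · obtain ⟨n, hn⟩ := Int.eq_ofNat_of_zero_le (show 0 ≤ m + 2 * k by omega)
    refine h2 ?_
    have : (m : K) + 2 * k = n := by exact_mod_cast hn
    rw [this]
    exact hc n (by omega)
  · obtain ⟨n, hn⟩ := Int.eq_ofNat_of_zero_le (show 0 ≤ -m by omega)
    refine grade_neg_ne_bot h1 ?_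
    have : -(m : K) = n := by exact_mod_cast hn
    rw [this]
    exact hc n (by omega)

lemma finrank_ker_ad : finrank K (LinearMap.ker (ad K g N)) =
    finrank K (grade K a (0 : K)) + finrank K (grade K a (-1 : K)) := by
  set P := genProj (ad K g a)
  let A : Submodule K g := ⨅ m : {m : ℤ // m ≤ -2}, LinearMap.ker (P (m : ℤ))
  let B : Submodule K g := ⨅ m : {m : ℤ // m ≤ 0}, LinearMap.ker (P (m : ℤ))
  have hA {x : g} : x ∈ A ↔ ∀ m : ℤ, m ≤ -2 → P m x = 0 := by simp [A]
  have hB {x : g} : x ∈ B ↔ ∀ m : ℤ, m ≤ 0 → P m x = 0 := by simp [B]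
  have hshift (m : ℤ) (x : g) : P (m + 2 : ℤ) ⁅N, x⁆ = ⁅N, P m x⁆ := by
    push_cast; exact LieAlgebra.genProj_lie t.mem_grade x
  have hAB : ∀ x, x ∈ A ↔ ad K g N x ∈ B := fun x ↦ by
    rw [hA, hB]
    refine ⟨fun h m hm ↦ ?_, fun h m hm ↦ ?_⟩
    · have := hshift (m - 2) x
      rw [h (m - 2) (by omega)] at this
      simpa using this
    · refine t.eq_zero_of_lie_eq_zero_of_mem_grade (m := m) (by omega)
        (genProj_mem (ad K g a) (m : K) x) ?_
      rw [← hshift]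
      exact h _ (by omega)
  have hker {w : g} (hw : ⁅N, w⁆ = 0) (m : ℤ) (hm : m < 0) : P m w = 0 := by
    refine t.eq_zero_of_lie_eq_zero_of_mem_grade hm (genProj_mem (ad K g a) (m : K) w) ?_
    rw [← hshift, hw, map_zero]
  have horth {b w : g} (hb : b ∈ B) (hw : ⁅N, w⁆ = 0) : killingForm K g b w = 0 := by
    refine killingForm_eq_zero_of_genProj (a := a) fun μ ↦ ?_
    by_contra! h
    obtain ⟨m, rfl⟩ := t.exists_intCast_of_genProj_ne_zero h.2
    rcases lt_or_ge m 0 with hm | hm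
    · exact h.2 (hker hw m hm)
    · exact h.1 (by simpa using hB.1 hb (-m) (by omega))
  have hBr : B ≤ LinearMap.range (ad K g N) := fun b hb ↦
    mem_range_ad_of_killingForm_eq_zero fun w hw ↦ horth hb hw
  have hkA : LinearMap.ker (ad K g N) ≤ A := fun w hw ↦
    hA.2 fun m hm ↦ hker hw m (by omega)
  have e1 : finrank K A = finrank K B + finrank K (LinearMap.ker (ad K g N)) := by
    let F : A →ₗ[K] B := (ad K g N).restrict fun x hx ↦ (hAB x).1 hx
    have hF : LinearMap.range F = ⊤ := by
      rw [LinearMap.range_eq_top]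
      rintro ⟨b, hb⟩
      obtain ⟨x, rfl⟩ := hBr hb
      exact ⟨⟨x, (hAB x).2 hb⟩, rfl⟩
    have hk : LinearMap.ker F = (LinearMap.ker (ad K g N)).comap A.subtype := by
      ext x; simp [F, LinearMap.restrict_apply]
    have := F.finrank_range_add_finrank_ker
    rw [hF, finrank_top, hk, (Submodule.comapSubtypeEquivOfLe hkA).finrank_eq] at this
    exact this.symm
  have e2 : finrank K A = (finrank K (grade K a (0 : K)) + finrank K (grade K a (-1 : K))) +
      finrank K B := by
    let F : A →ₗ[K] (grade K a (0 : K)) × (grade K a (-1 : K)) :=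
      (((P 0).codRestrict _ (genProj_mem _ _)).prod ((P (-1)).codRestrict _ (genProj_mem _ _))) ∘ₗ
        A.subtype
    have hBA : B ≤ A := fun x hx ↦ hA.2 fun m hm ↦ hB.1 hx m (by omega)
    have hk : LinearMap.ker F = B.comap A.subtype := by
      ext ⟨x, hx⟩
      simp only [LinearMap.mem_ker, Submodule.mem_comap, Submodule.subtype_apply, hB, F,
        LinearMap.comp_apply, LinearMap.prod_apply]
      simp only [Prod.ext_iff, Function.prod, Prod.fst_zero, Prod.snd_zero, Subtype.ext_iff,
        LinearMap.codRestrict_apply, ZeroMemClass.coe_zero]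
      refine ⟨fun h m hm ↦ ?_, fun h ↦ ?_⟩
      · obtain hm | rfl | rfl : m ≤ -2 ∨ m = -1 ∨ m = 0 := by omega
        · exact hA.1 hx m hm
        · simpa using h.2
        · simpa using h.1
      · have h1 := h 0 le_rfl
        have h2 := h (-1) (by omega)
        push_cast at h1 h2
        exact ⟨h1, h2⟩
    have hF : LinearMap.range F = ⊤ := by
      rw [LinearMap.range_eq_top]
      rintro ⟨⟨u, hu⟩, ⟨v, hv⟩⟩
      have hmem : u + v ∈ A := hA.2 fun m hm ↦ by
        have h1 : (m : K) ≠ 0 := by exact_mod_cast (by omega : m ≠ 0)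
        have h2 : (m : K) ≠ -1 := by exact_mod_cast (by omega : m ≠ -1)
        rw [map_add, genProj_of_mem_of_ne hu h1, genProj_of_mem_of_ne hv h2, add_zero]
      refine ⟨⟨u + v, hmem⟩, ?_⟩
      have h01 : (0 : K) ≠ -1 := by simp
      ext
      · change P 0 (u + v) = u
        rw [map_add, genProj_of_mem hu, genProj_of_mem_of_ne hv h01, add_zero]
      · change P (-1) (u + v) = v
        rw [map_add, genProj_of_mem hv, genProj_of_mem_of_ne hu h01.symm, zero_add]
    have := F.finrank_range_add_finrank_ker
    rw [hF, finrank_top, hk, (Submodule.comapSubtypeEquivOfLe hBA).finrank_eq,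
      Module.finrank_prod] at this
    exact this.symm
  omega

end IsHalfTriple

section Commutator

variable {V : Type*} [CharZero K] [IsAlgClosed K] [AddCommGroup V] [Module K V]
  [FiniteDimensional K V] {X Z c : End K V}

lemma isNilpotent_of_commute_commutator (h : X * Z - Z * X = c) (hc : Commute X c) :
    IsNilpotent c := by
  have h0 : ∀ μ, μ ≠ 0 → c.maxGenEigenspace μ = ⊥ := fun μ hμ ↦ by
    refine maxGenEigenspace_eq_bot_of_trace_eq_zero ?_ hμ
    have hX : X * genProj c μ = genProj c μ * X := by
      ext x
      have := genProj_apply_of_shift (A := c) (T := X) (c := 0) (fun ν y hy ↦ by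
        rw [add_zero]
        exact c.mapsTo_maxGenEigenspace_of_comm hc.symm ν hy) μ x
      rw [add_zero] at this
      exact this.symm
    have e : c * genProj c μ = (X * Z - Z * X) * genProj c μ := by rw [h]
    rw [e, sub_mul, mul_assoc Z, hX, map_sub, mul_assoc, LinearMap.trace_mul_comm, ← mul_assoc,
      sub_self]
  rw [Module.End.isNilpotent_iff_of_finite]
  intro x
  have hx : x ∈ c.maxGenEigenspace 0 := by
    have : x ∈ ⨆ μ, c.maxGenEigenspace μ := by simp [c.iSup_maxGenEigenspace_eq_top]
    refine (iSup_le fun μ ↦ ?_ : _ ≤ c.maxGenEigenspace 0) this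
    by_cases hμ : μ = 0
    · rw [hμ]
    · simp [h0 μ hμ]
  simpa [Module.End.mem_maxGenEigenspace] using hx

lemma isNilpotent_mul_of_commute_commutator (h : X * Z - Z * X = c) (hc : Commute X c)
    (hX : IsNilpotent X) : IsNilpotent (X * Z) := by
  obtain ⟨m, hm⟩ := isNilpotent_of_commute_commutator h hc
  have key : ∀ j : ℕ, X ^ j * (X * Z) = Z * X ^ (j + 1) + ((j : K) + 1) • (c * X ^ j) := fun j ↦ by
    induction j with
    | zero => simp [← h]
    | succ j ih =>
      have e : X * Z = Z * X + c := by rw [← h]; abel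
      rw [pow_succ', mul_assoc, ih, mul_add, ← mul_assoc, e, mul_smul_comm, ← mul_assoc X c, hc.eq,
        mul_assoc c, ← pow_succ', add_mul, mul_assoc, ← pow_succ']
      push_cast
      module
  have claim : ∀ j : ℕ, ∀ v, (X ^ j) v = 0 → ∃ n, ((X * Z) ^ n) v = 0 := fun j ↦ by
    induction j with
    | zero => exact fun v hv ↦ ⟨0, hv⟩
    | succ j ih =>
      intro v hv
      have h1 : ∀ n, (X ^ (j + 1)) (((X * Z) ^ n) v) = 0 ∧
          (X ^ j) (((X * Z) ^ n) v) = ((j : K) + 1) ^ n • (c ^ n) ((X ^ j) v) := fun n ↦ by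
        induction n with
        | zero => simpa using hv
        | succ n ih =>
          have h2 : (X ^ j) (((X * Z) ^ (n + 1)) v)
              = ((j : K) + 1) • c ((X ^ j) (((X * Z) ^ n) v)) := by
            rw [pow_succ' (X * Z), Module.End.mul_apply, ← Module.End.mul_apply, key]
            simp [ih.1]
          refine ⟨?_, ?_⟩
          · rw [pow_succ', Module.End.mul_apply, h2, map_smul, ← Module.End.mul_apply, hc.eq,
              Module.End.mul_apply, ← Module.End.mul_apply X, ← pow_succ', ih.1, map_zero,
              smul_zero]
          · rw [h2, ih.2, map_smul, smul_smul, ← pow_succ', pow_succ' c, Module.End.mul_apply]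
      obtain ⟨n, hn⟩ := ih (((X * Z) ^ m) v) (by rw [(h1 m).2, hm]; simp)
      exact ⟨n + m, by rw [pow_add, Module.End.mul_apply, hn]⟩
  obtain ⟨n, hn⟩ := hX
  rw [Module.End.isNilpotent_iff_of_finite]
  exact fun v ↦ claim n v (by simp [hn])

end Commutator

section Existence

variable [CharZero K] [IsAlgClosed K] [FiniteDimensional K g] [IsKilling K g]

lemma exists_isHalfTriple {N : g} (hN : IsNilpotent (ad K g N)) :
    ∃ y a : g, IsHalfTriple K N y a := by
  obtain ⟨y, hy⟩ : N ∈ LinearMap.range (ad K g N ^ 2) := by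
    refine mem_range_ad_pow_of_killingForm_eq_zero 2 fun z hz ↦ ?_
    have hz' : ⁅N, ⁅N, z⁆⁆ = 0 := by simpa [pow_two] using hz
    have h1 : ad K g N * ad K g z - ad K g z * ad K g N = ad K g ⁅N, z⁆ := by ext; simp
    have h2 : Commute (ad K g N) (ad K g ⁅N, z⁆) := by
      ext w
      have := leibniz_lie N ⁅N, z⁆ w
      rw [hz', zero_lie, zero_add] at this
      exact this
    rw [killingForm_apply_apply]
    refine IsNilpotent.eq_zero (LinearMap.isNilpotent_trace_of_isNilpotent ?_)
    exact isNilpotent_mul_of_commute_commutator h1 h2 hN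
  have hy' : ⁅N, ⁅N, y⁆⁆ = N := by simpa [pow_two] using hy
  refine ⟨(-2 : K) • y, ⁅N, (-2 : K) • y⁆, hN, rfl, ?_⟩
  rw [lie_smul, smul_lie, ← lie_skew, hy']
  simp

end Existence

end LieAlgebra

namespace LieAlgebra

open Module

section Jordan

variable {K g : Type*} [Field K] [LieRing g] [LieAlgebra K g]

variable (K) in
/-- An element whose adjoint endomorphism is diagonalizable. -/
def IsAdDiagonalizable (s : g) : Prop := ∀ μ : K, ∀ y ∈ grade K s μ, ⁅s, y⁆ = μ • y

variable [IsAlgClosed K] [FiniteDimensional K g]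

/-- The semisimple part of an element. -/
lemma exists_forall_mem_grade_lie_eq_smul [IsKilling K g] (x : g) :
    ∃ s : g, ∀ μ : K, ∀ y ∈ grade K x μ, ⁅s, y⁆ = μ • y := by
  classical
  let D : End K g := DirectSum.toModule K K g (fun μ ↦ μ • (grade K x μ).subtype) ∘ₗ
    (LinearEquiv.ofBijective (DirectSum.coeLinearMap fun ν ↦ grade K x ν)
      (isInternal_maxGenEigenspace (ad K g x))).symm.toLinearMap
  have hD : ∀ μ : K, ∀ y ∈ grade K x μ, D y = μ • y := fun μ y hy ↦ by
    have : (LinearEquiv.ofBijective (DirectSum.coeLinearMap fun ν ↦ grade K x ν)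
        (isInternal_maxGenEigenspace (ad K g x))).symm y = DirectSum.lof K K _ μ ⟨y, hy⟩ := by
      rw [LinearEquiv.symm_apply_eq]
      simp
    simp only [D, LinearMap.comp_apply, LinearEquiv.coe_coe, this, DirectSum.toModule_lof]
    simp
  have hder : ∀ u v : g, D ⁅u, v⁆ = ⁅u, D v⁆ - ⁅v, D u⁆ := fun u v ↦ by
    refine maxGenEigenspace_induction (p := fun u ↦ D ⁅u, v⁆ = ⁅u, D v⁆ - ⁅v, D u⁆) (ad K g x) u
      (fun μ u hu ↦ ?_) fun u u' h h' ↦ by simp only [add_lie, map_add, lie_add, h, h']; abel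
    refine maxGenEigenspace_induction (p := fun v ↦ D ⁅u, v⁆ = ⁅u, D v⁆ - ⁅v, D u⁆) (ad K g x) v
      (fun ν v hv ↦ ?_) fun v v' h h' ↦ by simp only [lie_add, map_add, add_lie, h, h']; abel
    rw [hD _ _ (lie_mem_grade hu hv), hD _ _ hu, hD _ _ hv, lie_smul, lie_smul, ← lie_skew u v]
    module
  obtain ⟨s, hs⟩ := LieDerivation.IsKilling.exists_eq_ad (R := K) (L := g) ⟨D, hder⟩
  refine ⟨s, fun μ y hy ↦ ?_⟩
  rw [← hD μ y hy, ← LieDerivation.ad_apply_apply K, hs]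
  rfl

variable {s x : g}

lemma grade_eq_of_forall_lie_eq_smul (h : ∀ μ : K, ∀ y ∈ grade K x μ, ⁅s, y⁆ = μ • y) (μ : K) :
    grade K s μ = grade K x μ := by
  have hle : ∀ μ : K, grade K x μ ≤ grade K s μ := fun μ y hy ↦ mem_grade_of_lie_eq (h μ y hy)
  refine le_antisymm (fun y hy ↦ ?_) (hle μ)
  have : genProj (ad K g x) μ y = y := by
    rw [← sub_eq_zero]
    refine eq_zero_of_forall_genProj_eq_zero (ad K g x) fun ν ↦ ?_
    have key : genProj (ad K g s) = genProj (ad K g x) := by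
      funext ν
      refine linearMap_ext_maxGenEigenspace (ad K g x) fun ρ z hz ↦ ?_
      classical
      rw [genProj_eq_ite hz, genProj_eq_ite (hle ρ hz)]
    rw [← key, genProj_of_mem hy, sub_self, map_zero]
  rw [← this]
  exact genProj_mem _ _ _

lemma isAdDiagonalizable_of_forall_lie_eq_smul
    (h : ∀ μ : K, ∀ y ∈ grade K x μ, ⁅s, y⁆ = μ • y) : IsAdDiagonalizable K s := fun μ y hy ↦
  h μ y (by rwa [← grade_eq_of_forall_lie_eq_smul h])

/-- An ad-diagonalizable element lies in a Cartan subalgebra. -/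
lemma IsAdDiagonalizable.exists_isCartanSubalgebra [CharZero K] (h : IsAdDiagonalizable K s) :
    ∃ H : LieSubalgebra K g, H.IsCartanSubalgebra ∧ s ∈ H := by
  let C := LieSubalgebra.engel K s
  have hC : ∀ y, y ∈ C ↔ ⁅s, y⁆ = 0 := fun y ↦ by
    rw [LieSubalgebra.mem_engel_iff]
    refine ⟨fun ⟨n, hn⟩ ↦ ?_, fun hy ↦ ⟨1, by simpa using hy⟩⟩
    have := h 0 y ((Module.End.mem_maxGenEigenspace _ _ _).2 ⟨n, by simpa using hn⟩)
    simpa using this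
  obtain ⟨x, hx⟩ := LieAlgebra.exists_isCartanSubalgebra_engel K C
  set H₀ := LieSubalgebra.engel K x
  have hs : ⟨s, (hC s).2 (lie_self s)⟩ ∈ H₀ := by
    rw [LieSubalgebra.mem_engel_iff]
    refine ⟨1, Subtype.ext ?_⟩
    rw [pow_one, ad_apply, LieSubalgebra.coe_bracket, ← lie_skew, (hC x).1 x.2, neg_zero]
    rfl
  refine ⟨H₀.map C.incl, ⟨?_, ?_⟩, ⟨_, hs, rfl⟩⟩
  · exact (LieEquiv.nilpotent_iff_equiv_nilpotent
      (H₀.equivMapOfInjective C.incl Subtype.val_injective)).1 hx.nilpotent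
  · refine le_antisymm (fun y hy ↦ ?_) (LieSubalgebra.le_normalizer _)
    rw [LieSubalgebra.mem_normalizer_iff'] at hy
    have hyC : y ∈ C := by
      obtain ⟨w, -, hw⟩ := hy s ⟨_, hs, rfl⟩
      have : ⁅s, ⁅s, y⁆⁆ = 0 := by rw [← hw]; exact (hC _).1 w.2
      rw [LieSubalgebra.mem_engel_iff]
      exact ⟨2, by simpa [pow_two] using this⟩
    refine ⟨⟨y, hyC⟩, ?_, rfl⟩
    change (⟨y, hyC⟩ : C) ∈ H₀
    rw [← hx.self_normalizing, LieSubalgebra.mem_normalizer_iff']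
    intro z hz
    obtain ⟨w, hw, hwz⟩ := hy z ⟨z, hz, rfl⟩
    have : w = ⁅z, ⟨y, hyC⟩⁆ := Subtype.ext hwz
    exact this ▸ hw

end Jordan

end LieAlgebra

namespace LieAlgebra

open Module

section Cartan

variable {K g : Type*} [Field K] [CharZero K] [IsAlgClosed K] [LieRing g] [LieAlgebra K g]
  [FiniteDimensional K g] [IsKilling K g] (H : LieSubalgebra K g) [H.IsCartanSubalgebra]

omit [CharZero K] [IsKilling K g] in
lemma rootSpace_induction {p : g → Prop} (x : g) (zero : p 0) (cartan : ∀ x ∈ H, p x)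
    (root : ∀ α : LieModule.Weight K H g, α.IsNonZero → ∀ x ∈ rootSpace H α, p x)
    (add : ∀ x y, p x → p y → p (x + y)) : p x := by
  have hx : x ∈ ⨆ α : LieModule.Weight K H g, (rootSpace H α).toSubmodule := by
    rw [← LieSubmodule.iSup_toSubmodule, LieModule.iSup_genWeightSpace_eq_top']
    trivial
  refine Submodule.iSup_induction _ (motive := p) hx (fun α x hx ↦ ?_) zero add
  by_cases hα : α.IsZero
  · rw [hα.eq, rootSpace_zero_eq] at hx
    exact cartan x hx
  · exact root α hα x hx

omit [IsKilling K g] in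
lemma exists_mem_forall_weight_ne_zero :
    ∃ x : H, ∀ α : LieModule.Weight K H g, α.IsNonZero → α x ≠ 0 := by
  obtain ⟨x, hx⟩ := Module.Dual.exists_forall_ne_zero_of_forall_exists
    (ι := {α : LieModule.Weight K H g // α.IsNonZero}) (fun α ↦ α.1.toLinear) fun α ↦ by
      by_contra! h
      exact α.2 (funext h)
  exact ⟨x, fun α hα ↦ hx ⟨α, hα⟩⟩

variable {H}

/-- If `χ` takes the value `μ` exactly on certain weights, then the generalized eigenspace of an
element of a Cartan subalgebra is the sum of the corresponding root spaces. -/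
lemma mem_of_mem_grade_of_forall_rootSpace_le (a : H) {μ : K} {W : Submodule K g}
    (h0 : μ = 0 → H.toSubmodule ≤ W)
    (h : ∀ α : LieModule.Weight K H g, α.IsNonZero → α a = μ → (rootSpace H α).toSubmodule ≤ W)
    {x : g} (hx : x ∈ grade K (a : g) μ) : x ∈ W := by
  rw [← genProj_of_mem hx]
  refine rootSpace_induction H (p := fun x ↦ genProj (ad K g a) μ x ∈ W) x (by simp)
    (fun y hy ↦ ?_) (fun α hα y hy ↦ ?_) fun x y hx hy ↦ by rw [map_add]; exact add_mem hx hy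
  · classical
    have : y ∈ grade K (a : g) 0 := mem_grade_of_lie_eq (by
      have := LieSubalgebra.coe_bracket H a ⟨y, hy⟩
      rw [LieModule.IsTrivial.trivial] at this
      simpa using this.symm)
    rw [genProj_eq_ite this]
    split_ifs with hμ
    · exact h0 hμ hy
    · exact zero_mem _
  · classical
    have : y ∈ grade K (a : g) (α a) := mem_grade_of_lie_eq
      (IsKilling.lie_eq_smul_of_mem_rootSpace hy a)
    rw [genProj_eq_ite this]
    split_ifs with hμ
    · exact h α hα hμ.symm hy
    · exact zero_mem _

omit [CharZero K] [IsAlgClosed K] in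
lemma lie_eq_zero_of_mem_cartan {x y : g} (hx : x ∈ H) (hy : y ∈ H) : ⁅x, y⁆ = 0 := by
  have := LieSubalgebra.coe_bracket H ⟨x, hx⟩ ⟨y, hy⟩
  rw [LieModule.IsTrivial.trivial] at this
  simpa using this.symm

omit [CharZero K] [IsAlgClosed K] in
lemma mem_grade_zero_of_mem_cartan {x y : g} (hx : x ∈ H) (hy : y ∈ H) : y ∈ grade K x 0 :=
  mem_grade_of_lie_eq (by rw [lie_eq_zero_of_mem_cartan hx hy, zero_smul])

omit [CharZero K] [IsAlgClosed K] in
lemma finrank_le_finrank_engel {x : g} (hx : x ∈ H) :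
    finrank K H ≤ finrank K (LieSubalgebra.engel K x) := by
  refine Submodule.finrank_mono (s := H.toSubmodule) (t := (LieSubalgebra.engel K x).toSubmodule)
    fun y hy ↦ ?_
  change y ∈ LieSubalgebra.engel K x
  rw [LieSubalgebra.mem_engel_iff]
  exact ⟨1, by simpa using lie_eq_zero_of_mem_cartan hx hy⟩

lemma engel_eq_of_forall_weight_ne_zero (a : H)
    (ha : ∀ α : LieModule.Weight K H g, α.IsNonZero → α a ≠ 0) :
    LieSubalgebra.engel K (a : g) = H := by
  refine le_antisymm (fun x hx ↦ ?_) fun x hx ↦ ?_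
  · rw [LieSubalgebra.mem_engel_iff] at hx
    obtain ⟨n, hn⟩ := hx
    exact mem_of_mem_grade_of_forall_rootSpace_le (W := H.toSubmodule) a (μ := 0) (fun _ ↦ le_rfl)
      (fun α hα h ↦ absurd h (ha α hα))
      ((Module.End.mem_maxGenEigenspace _ _ _).2 ⟨n, by simpa using hn⟩)
  · rw [LieSubalgebra.mem_engel_iff]
    exact ⟨1, by simpa using lie_eq_zero_of_mem_cartan a.2 hx⟩

end Cartan

section Polynomial

open MvPolynomial

variable {K g ι : Type*} [Field K] [LieRing g] [LieAlgebra K g] [Fintype ι] [DecidableEq ι]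
  (b : Module.Basis ι K g)

/-- Evaluation of a polynomial in the coordinates with respect to a basis. -/
noncomputable def evalAt (x : g) : MvPolynomial ι K →ₐ[K] K := aeval (b.repr x)

/-- The directional derivative along a vector. -/
noncomputable def dirDeriv (v : g) : Derivation K (MvPolynomial ι K) (MvPolynomial ι K) :=
  mkDerivation K fun i ↦ C (b.repr v i)

/-- The derivative along the linear vector field `x ↦ ⁅y, x⁆`. -/
noncomputable def adDeriv (y : g) : Derivation K (MvPolynomial ι K) (MvPolynomial ι K) :=
  mkDerivation K fun i ↦ ∑ j, C (b.repr ⁅y, b j⁆ i) * X j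

omit [DecidableEq ι] in
lemma repr_lie (y v : g) (i : ι) :
    b.repr ⁅y, v⁆ i = ∑ j, b.repr ⁅y, b j⁆ i * b.repr v j := by
  conv_lhs => rw [← b.sum_repr v]
  rw [lie_sum, map_sum, Finsupp.finsetSum_apply]
  simp only [lie_smul, map_smul, Finsupp.smul_apply, smul_eq_mul, mul_comm]

omit [DecidableEq ι] in
lemma evalAt_adDeriv (x y : g) (p : MvPolynomial ι K) :
    evalAt b x (adDeriv b y p) = evalAt b x (dirDeriv b ⁅y, x⁆ p) := by
  induction p using MvPolynomial.induction_on with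
  | C a => simp [derivation_C]
  | add p q hp hq => simp [hp, hq]
  | mul_X p i hp =>
    simp only [Derivation.leibniz, smul_eq_mul, map_add, map_mul, hp]
    congr 2
    simp [evalAt, adDeriv, dirDeriv, mkDerivation_X, repr_lie b y x i]

omit [DecidableEq ι] in
lemma adDeriv_dirDeriv (y v : g) (p : MvPolynomial ι K) :
    adDeriv b y (dirDeriv b v p) = dirDeriv b v (adDeriv b y p) - dirDeriv b ⁅y, v⁆ p := by
  have : ⁅adDeriv b y, dirDeriv b v⁆ = - dirDeriv b ⁅y, v⁆ := by
    refine derivation_ext fun i ↦ ?_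
    simp only [Derivation.commutator_apply, Derivation.neg_apply, adDeriv, dirDeriv,
      mkDerivation_X, derivation_C, map_sum, zero_sub, repr_lie b y v i, map_mul]
    simp
  have h := congrArg (fun D ↦ D p) this
  simp only [Derivation.commutator_apply, Derivation.neg_apply] at h
  rw [sub_eq_add_neg, ← h]
  ring

omit [Fintype ι] [DecidableEq ι] in
lemma dirDeriv_add (v w : g) (p : MvPolynomial ι K) :
    dirDeriv b (v + w) p = dirDeriv b v p + dirDeriv b w p := by
  have : dirDeriv b (v + w) = dirDeriv b v + dirDeriv b w :=
    derivation_ext fun i ↦ by simp [dirDeriv, mkDerivation_X]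
  rw [this, Derivation.add_apply]

omit [Fintype ι] [DecidableEq ι] in
lemma dirDeriv_smul (c : K) (v : g) (p : MvPolynomial ι K) :
    dirDeriv b (c • v) p = c • dirDeriv b v p := by
  have : dirDeriv b (c • v) = c • dirDeriv b v :=
    derivation_ext fun i ↦ by simp [dirDeriv, mkDerivation_X, smul_eq_C_mul]
  rw [this, Derivation.smul_apply]

omit [Fintype ι] in
lemma dirDeriv_basis (i : ι) : dirDeriv b (b i) = pderiv i := by
  refine derivation_ext fun j ↦ ?_
  simp [dirDeriv, mkDerivation_X, pderiv_X, Finsupp.single_apply, Pi.single_apply, eq_comm]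

/-- The restriction of a polynomial to the line through `x` with direction `v`. -/
noncomputable def lineEval (x v : g) : MvPolynomial ι K →ₐ[K] Polynomial K :=
  aeval fun i ↦ Polynomial.C (b.repr x i) + Polynomial.X * Polynomial.C (b.repr v i)

omit [Fintype ι] [DecidableEq ι] in
lemma eval_lineEval (x v : g) (t : K) (p : MvPolynomial ι K) :
    (lineEval b x v p).eval t = evalAt b (x + t • v) p := by
  have : (Polynomial.aeval t).comp (lineEval b x v) = evalAt b (x + t • v) := by
    ext i
    simp [lineEval, evalAt, mul_comm t]
  rw [← this]
  simp [Polynomial.coe_aeval_eq_eval]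

omit [Fintype ι] [DecidableEq ι] in
lemma derivative_lineEval (x v : g) (p : MvPolynomial ι K) :
    Polynomial.derivative (lineEval b x v p) = lineEval b x v (dirDeriv b v p) := by
  induction p using MvPolynomial.induction_on with
  | C a => simp [derivation_C, lineEval, Polynomial.algebraMap_eq]
  | add p q hp hq => simp [hp, hq]
  | mul_X p i hp =>
    simp only [Derivation.leibniz, smul_eq_mul, map_add, map_mul, Polynomial.derivative_mul, hp]
    simp [lineEval, dirDeriv, mkDerivation_X, Polynomial.algebraMap_eq]
    ring

/-- The matrix of the adjoint endomorphism of the generic element. -/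
noncomputable def genericAdMatrix : Matrix ι ι (MvPolynomial ι K) :=
  ∑ j, (X j : MvPolynomial ι K) • (LinearMap.toMatrix b b (ad K g (b j))).map C

lemma genericAdMatrix_map_evalAt (x : g) :
    (genericAdMatrix b).map (evalAt b x) = LinearMap.toMatrix b b (ad K g x) := by
  conv_rhs => rw [← b.sum_repr x]
  ext k l
  simp only [genericAdMatrix, Matrix.map_apply, Matrix.sum_apply, Matrix.smul_apply, map_sum,
    map_smul, evalAt, smul_eq_mul, map_mul, aeval_X, aeval_C]
  rfl

lemma genericAdMatrix_map_adDeriv (y : g) :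
    (genericAdMatrix b).map (adDeriv b y) =
      (LinearMap.toMatrix b b (ad K g y)).map C * genericAdMatrix b -
        genericAdMatrix b * (LinearMap.toMatrix b b (ad K g y)).map C := by
  have h1 : ∀ j, LinearMap.toMatrix b b (ad K g y) * LinearMap.toMatrix b b (ad K g (b j)) -
      LinearMap.toMatrix b b (ad K g (b j)) * LinearMap.toMatrix b b (ad K g y) =
      ∑ i, b.repr ⁅y, b j⁆ i • LinearMap.toMatrix b b (ad K g (b i)) := fun j ↦ by
    rw [← LinearMap.toMatrix_mul, ← LinearMap.toMatrix_mul, ← map_sub]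
    have : ad K g y * ad K g (b j) - ad K g (b j) * ad K g y = ad K g ⁅y, b j⁆ := by ext; simp
    rw [this]
    conv_lhs => rw [← b.sum_repr ⁅y, b j⁆]
    simp only [map_sum, map_smul]
  have h2 : (LinearMap.toMatrix b b (ad K g y)).map C * genericAdMatrix b -
        genericAdMatrix b * (LinearMap.toMatrix b b (ad K g y)).map C =
      ∑ j, (X j : MvPolynomial ι K) •
        (∑ i, b.repr ⁅y, b j⁆ i • LinearMap.toMatrix b b (ad K g (b i))).map C := by
    simp only [genericAdMatrix, Finset.mul_sum, Finset.sum_mul, ← Finset.sum_sub_distrib]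
    refine Finset.sum_congr rfl fun j _ ↦ ?_
    rw [← h1, Matrix.mul_smul, Matrix.smul_mul, ← smul_sub, Matrix.map_sub C (map_sub C),
      Matrix.map_mul, Matrix.map_mul]
  rw [h2]
  ext1 k l
  simp only [genericAdMatrix, Matrix.map_apply, Matrix.sum_apply, Matrix.smul_apply, map_sum,
    smul_eq_mul, Derivation.leibniz, derivation_C, mul_zero, zero_add, adDeriv, mkDerivation_X,
    Finset.mul_sum]
  rw [Finset.sum_comm]
  refine Finset.sum_congr rfl fun j _ ↦ ?_
  refine Finset.sum_congr rfl fun i _ ↦ ?_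
  rw [map_mul]
  ring


/-- The infinitesimal automorphism attached to the vector field `x ↦ ⁅y, x⁆`. -/
noncomputable def adDerivHom (y : g) : MvPolynomial ι K →+* DualNumber (MvPolynomial ι K) where
  toFun p := TrivSqZeroExt.inl p + TrivSqZeroExt.inr (adDeriv b y p)
  map_zero' := by simp
  map_one' := by simp
  map_add' p q := by ext1 <;> simp
  map_mul' p q := by ext1 <;> simp [Derivation.leibniz, mul_comm]

lemma adDeriv_charpoly_coeff (y : g) (d : ℕ) :
    adDeriv b y ((genericAdMatrix b).charpoly.coeff d) = 0 := by
  set M := genericAdMatrix b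
  set A : Matrix ι ι (MvPolynomial ι K) := (LinearMap.toMatrix b b (ad K g y)).map C
  let U : Matrix ι ι (DualNumber (MvPolynomial ι K)) :=
    (1 : Matrix ι ι _).map TrivSqZeroExt.inl + A.map TrivSqZeroExt.inr
  let V : Matrix ι ι (DualNumber (MvPolynomial ι K)) :=
    (1 : Matrix ι ι _).map TrivSqZeroExt.inl - A.map TrivSqZeroExt.inr
  have hfst (P Q : Matrix ι ι (DualNumber (MvPolynomial ι K))) :
      (P * Q).map TrivSqZeroExt.fst = P.map TrivSqZeroExt.fst * Q.map TrivSqZeroExt.fst := by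
    ext k l : 2
    simp [Matrix.mul_apply, TrivSqZeroExt.fst_sum]
  have hsnd (P Q : Matrix ι ι (DualNumber (MvPolynomial ι K))) :
      (P * Q).map TrivSqZeroExt.snd = P.map TrivSqZeroExt.fst * Q.map TrivSqZeroExt.snd +
        P.map TrivSqZeroExt.snd * Q.map TrivSqZeroExt.fst := by
    ext k l : 2
    simp [Matrix.mul_apply, TrivSqZeroExt.snd_sum, Finset.sum_add_distrib]
  have hext {P Q : Matrix ι ι (DualNumber (MvPolynomial ι K))}
      (h1 : P.map TrivSqZeroExt.fst = Q.map TrivSqZeroExt.fst)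
      (h2 : P.map TrivSqZeroExt.snd = Q.map TrivSqZeroExt.snd) : P = Q := by
    ext1 k l
    exact TrivSqZeroExt.ext (congrFun (congrFun h1 k) l) (congrFun (congrFun h2 k) l)
  have hU1 : U.map TrivSqZeroExt.fst = 1 := by ext k l : 2; simp [U]
  have hU2 : U.map TrivSqZeroExt.snd = A := by ext k l : 2; simp [U]
  have hV1 : V.map TrivSqZeroExt.fst = 1 := by ext k l : 2; simp [V]
  have hV2 : V.map TrivSqZeroExt.snd = -A := by ext k l : 2; simp [V]
  have h11 : (1 : Matrix ι ι (DualNumber (MvPolynomial ι K))).map TrivSqZeroExt.fst = 1 := by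
    ext k l : 2; by_cases h : k = l <;> simp [h, Matrix.one_apply]
  have h12 : (1 : Matrix ι ι (DualNumber (MvPolynomial ι K))).map TrivSqZeroExt.snd = 0 := by
    ext k l : 2; by_cases h : k = l <;> simp [h]
  have hUV : U * V = 1 :=
    hext (by simp [hfst, hU1, hV1, h11]) (by simp [hsnd, hU1, hU2, hV1, hV2, h12])
  have hVU : V * U = 1 :=
    hext (by simp [hfst, hU1, hV1, h11]) (by simp [hsnd, hU1, hU2, hV1, hV2, h12])
  let u : (Matrix ι ι (DualNumber (MvPolynomial ι K)))ˣ := ⟨U, V, hUV, hVU⟩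
  have hM1 : (M.map (TrivSqZeroExt.inlHom (MvPolynomial ι K) (MvPolynomial ι K))).map
      TrivSqZeroExt.fst = M := by ext k l : 2; simp
  have hM2 : (M.map (TrivSqZeroExt.inlHom (MvPolynomial ι K) (MvPolynomial ι K))).map
      TrivSqZeroExt.snd = 0 := by ext k l : 2; simp
  have hD1 : (M.map (adDerivHom b y)).map TrivSqZeroExt.fst = M := by
    ext k l : 2; simp [adDerivHom]
  have hD2 : (M.map (adDerivHom b y)).map TrivSqZeroExt.snd = A * M - M * A := by
    rw [← genericAdMatrix_map_adDeriv b y]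
    ext k l : 2; simp [adDerivHom, M]
  have hconj : M.map (adDerivHom b y) =
      u.val * M.map (TrivSqZeroExt.inlHom (MvPolynomial ι K) (MvPolynomial ι K)) * u⁻¹.val :=
    hext (by simp only [u, Units.inv_mk, hfst, hM1, hD1, hU1, hV1]; simp)
      (by simp only [u, Units.inv_mk, hfst, hsnd, hM1, hM2, hD2, hU1, hU2, hV1, hV2]; simp
          abel)
  have key := congrArg Matrix.charpoly hconj
  rw [Matrix.coe_units_inv, Matrix.charpoly_units_conj, Matrix.charpoly_map,
    Matrix.charpoly_map] at key
  have := congrArg (fun P ↦ TrivSqZeroExt.snd (P.coeff d)) key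
  simpa [Polynomial.coeff_map, adDerivHom] using this

end Polynomial

section Rank

open MvPolynomial

variable {K g ι : Type*} [Field K] [CharZero K] [IsAlgClosed K] [LieRing g] [LieAlgebra K g]
  [FiniteDimensional K g] [IsKilling K g] (H : LieSubalgebra K g) [H.IsCartanSubalgebra]
  [Fintype ι] [DecidableEq ι] (b : Module.Basis ι K g)

/-- A space of polynomials stable under the adjoint vector fields and vanishing on `H`. -/
structure IsStableVanishing (W : Submodule K (MvPolynomial ι K)) : Prop where
  stable : ∀ y, ∀ p ∈ W, adDeriv b y p ∈ W
  vanishing : ∀ x ∈ H, ∀ p ∈ W, evalAt b x p = 0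

variable {H b}

omit [DecidableEq ι] in
lemma IsStableVanishing.eval_dirDeriv {W : Submodule K (MvPolynomial ι K)}
    (hW : IsStableVanishing H b W) {p : MvPolynomial ι K} (hp : p ∈ W) (v : g) :
    ∀ x ∈ H, evalAt b x (dirDeriv b v p) = 0 := by
  refine rootSpace_induction H (p := fun v ↦ ∀ x ∈ H, evalAt b x (dirDeriv b v p) = 0) v
    (fun x _ ↦ ?_) (fun v hv x hx ↦ ?_) (fun α hα v hv x hx ↦ ?_) fun v w hv hw x hx ↦ ?_
  · rw [← zero_smul K (0 : g), dirDeriv_smul]; simp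
  · have h0 : lineEval b x v p = 0 := Polynomial.funext fun t ↦ by
      rw [eval_lineEval, Polynomial.eval_zero]
      exact hW.vanishing _ (add_mem hx (H.smul_mem t hv)) _ hp
    have h1 := eval_lineEval b x v 0 (dirDeriv b v p)
    rw [← derivative_lineEval, h0] at h1
    simpa using h1.symm
  · obtain ⟨x₁, hx₁⟩ := exists_mem_forall_weight_ne_zero (K := K) (g := g) H
    have h0 : lineEval b x x₁ (dirDeriv b v p) *
        (Polynomial.C (α ⟨x, hx⟩) + Polynomial.X * Polynomial.C (α x₁)) = 0 :=
      Polynomial.funext fun t ↦ by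
        rw [Polynomial.eval_mul, eval_lineEval, Polynomial.eval_zero]
        have h1 := hW.vanishing _ (add_mem hx (H.smul_mem t x₁.2)) _ (hW.stable v _ hp)
        have h2 := IsKilling.lie_eq_smul_of_mem_rootSpace hv (⟨x, hx⟩ + t • x₁)
        rw [evalAt_adDeriv, ← lie_skew] at h1
        have h3 : ⁅x + t • (x₁ : g), v⁆ = (α ⟨x, hx⟩ + t * α x₁) • v := by
          have : α (⟨x, hx⟩ + t • x₁) = α ⟨x, hx⟩ + t * α x₁ := by
            simp
          rw [← this, ← h2]; rfl
        rw [h3, ← neg_smul, dirDeriv_smul, map_smul, smul_eq_mul] at h1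
        simp only [Polynomial.eval_add, Polynomial.eval_mul, Polynomial.eval_C, Polynomial.eval_X]
        linear_combination -h1
    have h4 := (mul_eq_zero.1 h0).resolve_right fun h ↦ hx₁ α hα (by
      have := congrArg (fun P ↦ Polynomial.coeff P 1) h
      simpa [Polynomial.coeff_X_mul] using this)
    have h5 := eval_lineEval b x x₁ 0 (dirDeriv b v p)
    rw [h4] at h5
    simpa using h5.symm
  · rw [dirDeriv_add, map_add, hv x hx, hw x hx, add_zero]

omit [DecidableEq ι] in
lemma IsStableVanishing.iSup_map_dirDeriv {W : Submodule K (MvPolynomial ι K)}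
    (hW : IsStableVanishing H b W) :
    IsStableVanishing H b (⨆ v, W.map (dirDeriv b v).toLinearMap) where
  stable y p hp := by
    induction hp using Submodule.iSup_induction' with
    | zero => simp
    | add p q _ _ hp hq => rw [map_add]; exact add_mem hp hq
    | mem v q hq =>
      obtain ⟨p, hp, rfl⟩ := hq
      change adDeriv b y (dirDeriv b v p) ∈ _
      rw [adDeriv_dirDeriv]
      exact sub_mem (Submodule.mem_iSup_of_mem v ⟨_, hW.stable y p hp, rfl⟩)
        (Submodule.mem_iSup_of_mem ⁅y, v⁆ ⟨_, hp, rfl⟩)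
  vanishing x hx p hp := by
    induction hp using Submodule.iSup_induction' with
    | zero => simp
    | add p q _ _ hp hq => rw [map_add, hp, hq, add_zero]
    | mem v q hq =>
      obtain ⟨p, hp, rfl⟩ := hq
      exact hW.eval_dirDeriv hp v x hx

lemma IsStableVanishing.coeff_eq_zero (m : ι →₀ ℕ) {W : Submodule K (MvPolynomial ι K)}
    (hW : IsStableVanishing H b W) {p : MvPolynomial ι K} (hp : p ∈ W) : coeff m p = 0 := by
  induction m using Finsupp.induction generalizing W p with
  | zero =>
    have := hW.vanishing 0 H.zero_mem p hp
    simpa [evalAt, MvPolynomial.aeval_zero', constantCoeff_eq] using this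
  | single_add i n f _ _ ih =>
    clear * - ih hW hp
    induction n generalizing W p with
    | zero => simpa using ih hW hp
    | succ n ihn =>
      have h1 : pderiv i p ∈ ⨆ v, W.map (dirDeriv b v).toLinearMap :=
        Submodule.mem_iSup_of_mem (b i) ⟨p, hp, by simp [dirDeriv_basis]⟩
      have h2 := ihn hW.iSup_map_dirDeriv h1
      rw [coeff_pderiv] at h2
      have h3 := (mul_eq_zero.1 h2).resolve_right (Nat.cast_add_one_ne_zero _)
      rwa [Finsupp.single_add, add_right_comm]

variable (H b) in
lemma eq_zero_of_adDeriv_eq_zero {p : MvPolynomial ι K} (hp : ∀ y, adDeriv b y p = 0)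
    (h : ∀ x ∈ H, evalAt b x p = 0) : p = 0 := by
  have : IsStableVanishing H b (K ∙ p) :=
    ⟨fun y q hq ↦ by
      obtain ⟨c, rfl⟩ := Submodule.mem_span_singleton.1 hq
      simp [hp],
    fun x hx q hq ↦ by
      obtain ⟨c, rfl⟩ := Submodule.mem_span_singleton.1 hq
      simp [h x hx]⟩
  ext m
  exact this.coeff_eq_zero m (Submodule.mem_span_singleton_self p)

omit [CharZero K] [IsAlgClosed K] [IsKilling K g] in
lemma evalAt_charpoly_coeff (x : g) (d : ℕ) :
    evalAt b x ((genericAdMatrix b).charpoly.coeff d) = (ad K g x).charpoly.coeff d := by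
  rw [← LinearMap.charpoly_toMatrix (ad K g x) b, ← genericAdMatrix_map_evalAt]
  have := Matrix.charpoly_map (genericAdMatrix b) (evalAt b x).toRingHom
  simp only [AlgHom.toRingHom_eq_coe, RingHom.coe_coe] at this
  rw [this, Polynomial.coeff_map]
  rfl

variable (H) in
/-- A Cartan subalgebra is no larger than any other one. -/
lemma finrank_cartan_le (H' : LieSubalgebra K g) [H'.IsCartanSubalgebra] :
    finrank K H ≤ finrank K H' := by
  by_contra! hlt
  let b := Module.finBasis K g
  obtain ⟨x, hx⟩ := exists_mem_forall_weight_ne_zero (K := K) (g := g) H'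
  have h0 : (genericAdMatrix b).charpoly.coeff (finrank K H') = 0 :=
    eq_zero_of_adDeriv_eq_zero H b (fun y ↦ adDeriv_charpoly_coeff b y _) fun z hz ↦ by
      rw [evalAt_charpoly_coeff]
      refine Polynomial.coeff_eq_zero_of_lt_natTrailingDegree ?_
      rw [← finrank_engel]
      exact hlt.trans_le (finrank_le_finrank_engel hz)
  have h1 := evalAt_charpoly_coeff (b := b) (x : g) (finrank K H')
  have h2 := finrank_engel K (x : g)
  rw [engel_eq_of_forall_weight_ne_zero x hx] at h2
  rw [h0, map_zero, h2] at h1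
  exact Polynomial.trailingCoeff_nonzero_iff_nonzero.2
    (LinearMap.charpoly_monic (ad K g (x : g))).ne_zero h1.symm

/-- All Cartan subalgebras have the same dimension. -/
theorem finrank_cartan_eq (H H' : LieSubalgebra K g) [H.IsCartanSubalgebra]
    [H'.IsCartanSubalgebra] : finrank K H = finrank K H' :=
  le_antisymm (finrank_cartan_le H H') (finrank_cartan_le H' H)

end Rank

end LieAlgebra

namespace RootPairing.Base

open Module Submodule

variable {ι K M N : Type*} [Finite ι] [Field K] [CharZero K] [AddCommGroup M] [Module K M]
  [AddCommGroup N] [Module K N] {P : RootPairing ι K M N} (b : P.Base)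
  [P.IsCrystallographic] [P.IsReduced] [P.IsIrreducible]

/-- The Dynkin diagram of an irreducible root system is connected. -/
lemma mem_of_forall_pairing_eq_zero {J : Set ι} (hJ : J ⊆ b.support) (hne : J.Nonempty)
    (h : ∀ i ∈ J, ∀ j ∈ b.support, j ∉ J → P.pairing i j = 0) {j : ι} (hj : j ∈ b.support) :
    j ∈ J := by
  have htop : span K (P.root '' J) = ⊤ := by
    refine IsIrreducible.eq_top_of_invtSubmodule_reflection (P := P) _
      ((b.forall_mem_support_invtSubmodule_iff _).1 fun j hj ↦ ?_) ?_
    · rw [Module.End.mem_invtSubmodule, span_le]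
      rintro _ ⟨i, hi, rfl⟩
      change P.reflection j (P.root i) ∈ span K (P.root '' J)
      rw [reflection_apply_root]
      by_cases hjJ : j ∈ J
      · exact sub_mem (subset_span ⟨i, hi, rfl⟩) (smul_mem _ _ (subset_span ⟨j, hjJ, rfl⟩))
      · rw [h i hi j hj hjJ, zero_smul, sub_zero]
        exact subset_span ⟨i, hi, rfl⟩
    · obtain ⟨i, hi⟩ := hne
      intro hbot
      have : P.root i ∈ span K (P.root '' J) := subset_span ⟨i, hi, rfl⟩
      rw [hbot, mem_bot] at this
      exact P.ne_zero i this
  by_contra hjJ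
  have h1 : P.root j ∉ span K (P.root '' J) :=
    ((b.linearIndepOn_root.mono hJ).notMem_span_iff).2
      ⟨b.linearIndepOn_root.mono (Set.insert_subset hj hJ), hjJ⟩
  exact h1 (htop ▸ mem_top)

/-- A root of maximal height involves all the simple roots. -/
lemma exists_root_eq_sum_of_forall_height_le {i : ι} (hi : ∀ j, b.height j ≤ b.height i) :
    ∃ f : ι → ℕ, (∀ j ∈ b.support, 1 ≤ f j) ∧ P.root i = ∑ j ∈ b.support, f j • P.root j := by
  obtain ⟨j₀, hj₀⟩ : b.support.Nonempty := by
    have := (⟨i⟩ : Nonempty ι)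
    exact b.support_nonempty
  have hpos : 1 ≤ b.height i := by simpa [height_one_of_mem_support hj₀] using hi j₀
  obtain ⟨f, hf, h | h⟩ := b.exists_root_eq_sum_nat_or_neg i
  swap
  · have h1 := height_eq_sum (b := b) (i := i) (f := fun j ↦ -(f j : ℤ)) (by simp [h])
    have h2 : 0 ≤ ∑ j ∈ b.support, (f j : ℤ) := by positivity
    simp only [Finset.sum_neg_distrib] at h1
    omega
  refine ⟨f, fun j hj ↦ ?_, h⟩
  suffices j ∈ {j ∈ (b.support : Set ι) | f j ≠ 0} from Nat.one_le_iff_ne_zero.2 this.2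
  refine b.mem_of_forall_pairing_eq_zero (fun j hj ↦ hj.1) ?_ (fun j hj k hk hkJ ↦ ?_) hj
  · by_contra! hempty
    refine P.ne_zero i ?_
    rw [h]
    refine Finset.sum_eq_zero fun j hj ↦ ?_
    have : f j = 0 := by
      by_contra hfj
      have : j ∈ (∅ : Set ι) := hempty ▸ ⟨hj, hfj⟩
      exact this
    rw [this, zero_smul]
  · have hfk : f k = 0 := by
      by_contra hfk
      exact hkJ ⟨hk, hfk⟩
    have hle (l) (hl : l ∈ b.support) : (f l : ℤ) * P.pairingIn ℤ l k ≤ 0 := by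
      rcases eq_or_ne l k with rfl | hlk
      · simp [hfk]
      · exact mul_nonpos_of_nonneg_of_nonpos (by positivity) (b.pairingIn_le_zero_of_ne hlk hl hk)
    have hsum : P.pairingIn ℤ i k = ∑ l ∈ b.support, (f l : ℤ) * P.pairingIn ℤ l k := by
      have h1 : P.pairing i k = ∑ l ∈ b.support, (f l : K) * P.pairing l k := by
        rw [← P.root_coroot'_eq_pairing, h, map_sum]
        refine Finset.sum_congr rfl fun l _ ↦ ?_
        rw [map_nsmul, P.root_coroot'_eq_pairing, nsmul_eq_mul]
      apply FaithfulSMul.algebraMap_injective ℤ K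
      rw [P.algebraMap_pairingIn, h1, map_sum]
      refine Finset.sum_congr rfl fun l _ ↦ ?_
      rw [map_mul, P.algebraMap_pairingIn]
      simp
    have hzero : P.pairingIn ℤ i k = 0 := by
      refine le_antisymm (hsum ▸ Finset.sum_nonpos hle) ?_
      by_contra! hlt
      have hne : P.root i ≠ -P.root k := fun heq ↦ by
        let := P.indexNeg
        have h1 : P.root i = P.root (-k) := by simpa using heq
        have h2 := b.height_reflectionPerm_self k
        rw [← P.root.injective h1, height_one_of_mem_support hk] at h2
        omega
      obtain ⟨l, hl⟩ := P.root_add_root_mem_of_pairingIn_neg hlt hne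
      have h1 := b.height_add hl
      rw [height_one_of_mem_support hk] at h1
      have := hi l
      omega
    have h2 := (Finset.sum_eq_zero_iff_of_nonpos hle).1 (hsum ▸ hzero) j hj.1
    have h3 : P.pairingIn ℤ j k = 0 :=
      (mul_eq_zero.1 h2).resolve_left (by exact_mod_cast hj.2)
    rw [← P.algebraMap_pairingIn ℤ, h3, map_zero]

end RootPairing.Base

namespace LieAlgebra

open Module IsKilling

variable {K g : Type*} [Field K] [CharZero K] [IsAlgClosed K] [LieRing g] [LieAlgebra K g]
  [FiniteDimensional K g] [IsKilling K g] {H : LieSubalgebra K g} [H.IsCartanSubalgebra]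

/-- An element on which the roots take integral values is dominant for a suitable base. -/
lemma exists_base_forall_natCast (s : H) (hs : ∀ i : H.root, ∃ n : ℤ, i.1 s = n) :
    ∃ b : (rootSystem H).Base, ∀ i ∈ b.support, ∃ n : ℕ, i.1 s = n := by
  let P := rootSystem H
  let _i : Module ℚ (Dual K H) := Module.compHom (Dual K H) (algebraMap ℚ K)
  obtain ⟨f₀, hf₀⟩ : ∃ f : Dual ℚ (Dual K H), ∀ i, f (P.root i) ≠ 0 :=
    exists_dual_forall_apply_ne_zero P.root <| by simp [P.ne_zero]
  obtain ⟨φ, hφ⟩ := LinearMap.exists_leftInverse_of_injective (Algebra.linearMap ℚ K)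
    (LinearMap.ker_eq_bot.2 (algebraMap ℚ K).injective)
  have hφn (n : ℤ) : φ n = n := by
    have := LinearMap.congr_fun hφ n
    simpa using this
  obtain ⟨C, hC⟩ := Finite.exists_le (fun i : H.root ↦ |f₀ (P.root i)|)
  obtain ⟨c, hc⟩ := exists_nat_gt C
  let f : Dual K H →+ ℚ :=
    (c : ℚ) • (φ.toAddMonoidHom.comp (LinearMap.applyₗ (R := K) s).toAddMonoidHom) +
      f₀.toAddMonoidHom
  have hf (i : H.root) {n : ℤ} (hn : i.1 s = n) : f (P.root i) = c * n + f₀ (P.root i) := by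
    have : φ (P.root i s) = n := by rw [← hφn, ← hn]; rfl
    change (c : ℚ) • φ (P.root i s) + f₀ (P.root i) = _
    rw [this, smul_eq_mul]
  have hlt (i : H.root) : |f₀ (P.root i)| < c := (hC i).trans_lt hc
  have hne (i : H.root) : f (P.root i) ≠ 0 := by
    obtain ⟨n, hn⟩ := hs i
    rw [hf i hn]
    rcases lt_trichotomy n 0 with h | rfl | h
    · have h1 : (n : ℚ) ≤ -1 := by exact_mod_cast (by omega : n ≤ -1)
      have := abs_lt.1 (hlt i)
      nlinarith
    · simpa using hf₀ i
    · have h1 : (1 : ℚ) ≤ n := by exact_mod_cast h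
      have := abs_lt.1 (hlt i)
      nlinarith
  let := P.indexNeg
  refine ⟨RootPairing.Base.mk' P (IsAddIndecomposable.baseOf P.root f)
    (P.linearIndepOn_root_baseOf f hne)
    fun i ↦ IsAddIndecomposable.mem_or_neg_mem_closure_baseOf P.root f i (hne i) (by simp),
    fun i hi ↦ ?_⟩
  have hi' : i ∈ IsAddIndecomposable.baseOf P.root f := by
    simpa [RootPairing.Base.mk'] using hi
  obtain ⟨hpos, -⟩ := hi'
  obtain ⟨n, hn⟩ := hs i
  rw [Set.mem_ofPred_eq, hf i hn] at hpos
  have h0 : 0 ≤ n := by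
    by_contra! h
    have h1 : (n : ℚ) ≤ -1 := by exact_mod_cast (by omega : n ≤ -1)
    have := abs_lt.1 (hlt i)
    nlinarith
  exact ⟨n.toNat, by rw [hn, ← Int.cast_natCast, Int.toNat_of_nonneg h0]⟩

variable (b : (rootSystem H).Base)

lemma exists_forall_mem_support_apply_eq (c : H.root → K) :
    ∃ u : H, ∀ i ∈ b.support, i.1 u = c i := by
  let f : Dual K (Dual K H) := b.toWeightBasis.constr K fun i ↦ c i
  obtain ⟨u, hu⟩ := (Module.evalEquiv K H).surjective f
  refine ⟨u, fun i hi ↦ ?_⟩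
  have h1 := LinearMap.congr_fun hu (b.toWeightBasis ⟨i, hi⟩)
  rw [Basis.constr_basis] at h1
  simpa using h1

lemma apply_eq_sum_of_root_eq {i : H.root} {f : H.root → ℕ}
    (h : (rootSystem H).root i = ∑ j ∈ b.support, f j • (rootSystem H).root j) (u : H) :
    i.1 u = ∑ j ∈ b.support, f j * j.1 u := by
  have := LinearMap.congr_fun h u
  simpa [LinearMap.sum_apply] using this

lemma apply_eq_two_mul_height {a : H} (ha : ∀ i ∈ b.support, i.1 a = 2) (i : H.root) :
    i.1 a = ((2 * b.height i : ℤ) : K) := by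
  obtain ⟨f, -, -, hf⟩ := b.exists_root_eq_sum_int i
  rw [b.height_eq_sum hf]
  have := LinearMap.congr_fun hf a
  simp only [LinearMap.sum_apply, LinearMap.smul_apply, rootSystem_root_apply] at this
  have h2 : i.1 a = ∑ j ∈ b.support, f j • j.1 a := by simpa using this
  rw [h2]
  push_cast
  rw [Finset.mul_sum]
  refine Finset.sum_congr rfl fun j hj ↦ ?_
  rw [ha j hj, zsmul_eq_mul, mul_comm]

lemma eq_zero_of_forall_mem_support_apply_eq_zero {u : H} (hu : ∀ i ∈ b.support, i.1 u = 0) :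
    u = 0 := by
  refine (Module.forall_dual_apply_eq_zero_iff K u).1 fun φ ↦ ?_
  rw [← b.toWeightBasis.sum_repr φ, LinearMap.sum_apply]
  refine Finset.sum_eq_zero fun i _ ↦ ?_
  simp [hu i i.2]

end LieAlgebra

namespace RootPairing.Base

variable {ι R M N : Type*} [Finite ι] [CommRing R] [CharZero R] [IsDomain R] [AddCommGroup M]
  [Module R M] [AddCommGroup N] [Module R N] {P : RootPairing ι R M N} [P.IsReduced] (b : P.Base)

omit [Finite ι] [IsDomain R] [P.IsReduced] in
lemma mem_support_of_height_eq_one {i : ι} (hi : b.height i = 1) : i ∈ b.support := by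
  classical
  obtain ⟨f, -, hf | hf⟩ := b.exists_root_eq_sum_nat_or_neg i
  · have hf' : P.root i = ∑ j ∈ b.support, (f j : ℤ) • P.root j := by simpa using hf
    rw [b.height_eq_sum hf'] at hi
    replace hi : ∑ j ∈ b.support, f j = 1 := by exact_mod_cast hi
    obtain ⟨j, hj, hj0⟩ : ∃ j ∈ b.support, f j ≠ 0 := by
      by_contra! h
      simp [Finset.sum_eq_zero h] at hi
    rw [← Finset.add_sum_erase _ _ hj] at hi
    have h0 : ∑ k ∈ b.support.erase j, f k = 0 := by omega
    rw [← Finset.add_sum_erase _ _ hj, Finset.sum_eq_zero fun k hk ↦ by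
      rw [(Finset.sum_eq_zero_iff.1 h0) k hk, zero_smul], add_zero,
      show f j = 1 by omega, one_smul] at hf
    rwa [P.root.injective hf]
  · have hf' : P.root i = ∑ j ∈ b.support, (-(f j : ℤ)) • P.root j := by
      simpa [← Finset.sum_neg_distrib] using hf
    rw [b.height_eq_sum hf', Finset.sum_neg_distrib] at hi
    have : 0 ≤ ∑ j ∈ b.support, (f j : ℤ) := by positivity
    omega

end RootPairing.Base

namespace LieAlgebra

open Module IsKilling

variable {K g : Type*} [Field K] [CharZero K] [IsAlgClosed K] [LieRing g] [LieAlgebra K g]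
  [FiniteDimensional K g]

section Killing

variable [IsKilling K g] {H : LieSubalgebra K g} [H.IsCartanSubalgebra]

lemma exists_root_eq_sub_of_lie_ne_zero {i j : H.root} (hij : i ≠ j) {x y : g}
    (hx : x ∈ rootSpace H i.1) (hy : y ∈ rootSpace H (-j.1)) (h : ⁅x, y⁆ ≠ 0) :
    ∃ k, (rootSystem H).root k = (rootSystem H).root i - (rootSystem H).root j := by
  have hmem : ⁅x, y⁆ ∈ rootSpace H (i.1 + -j.1) :=
    lie_mem_genWeightSpace_of_mem_genWeightSpace hx hy
  have hne : rootSpace H (i.1 + -j.1 : H → K) ≠ ⊥ := fun h0 ↦ h (by simpa [h0] using hmem)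
  let α : LieModule.Weight K H g := ⟨_, hne⟩
  have hα : α.IsNonZero := fun h0 ↦ by
    exact hij (Subtype.ext (LieModule.Weight.ext fun u ↦ by
      simpa [α, add_neg_eq_zero] using congrFun h0 u))
  refine ⟨⟨α, by simpa [LieSubalgebra.root] using hα⟩, ?_⟩
  ext u
  simp [α, sub_eq_add_neg]

variable (H) in
lemma exists_rootVectors : ∃ e f : H.root → g, (∀ i, e i ∈ rootSpace H i.1) ∧
    (∀ i, f i ∈ rootSpace H (-i.1)) ∧ (∀ i, e i ≠ 0) ∧ ∀ i, ⁅e i, f i⁆ = (coroot i.1 : g) := by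
  have h (i : H.root) : ∃ e f, e ∈ rootSpace H i.1 ∧ f ∈ rootSpace H (-i.1) ∧ e ≠ 0 ∧
      ⁅e, f⁆ = (coroot i.1 : g) := by
    have hi : i.1.IsNonZero := H.isNonZero_coe_root i
    obtain ⟨h, e, f, ht, he, hf⟩ := exists_isSl2Triple_of_weight_isNonZero hi
    exact ⟨e, f, he, hf, ht.e_ne_zero, by rw [ht.lie_e_f, ht.h_eq_coroot hi he hf]⟩
  choose e f he hf h0 h1 using h
  exact ⟨e, f, he, hf, h0, h1⟩

lemma exists_eq_smul_of_mem_rootSpace {α : LieModule.Weight K H g} (hα : α.IsNonZero) {e x : g}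
    (he : e ∈ rootSpace H α) (he0 : e ≠ 0) (hx : x ∈ rootSpace H α) : ∃ c : K, x = c • e := by
  have := finrank_rootSpace_eq_one α hα
  obtain ⟨c, hc⟩ :=
    (finrank_eq_one_iff_of_nonzero' (⟨e, he⟩ : rootSpace H α) (by simpa using he0)).1
    this ⟨x, hx⟩
  exact ⟨c, by simpa using congrArg Subtype.val hc.symm⟩

lemma coroot_coe_ne_zero (i : H.root) : (coroot i.1 : g) ≠ 0 := by
  have hi : i.1.IsNonZero := H.isNonZero_coe_root i
  simp

end Killing

/-- The grading of a Lie algebra by the heights of its roots, where a root of height `k` has degree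
`2 * k` and heights run from `-M` to `M`. -/
structure IsPrincipalGrading (H : LieSubalgebra K g) (e y a : g) (M : ℕ) : Prop where
  halfTriple : IsHalfTriple K e y a
  diag : IsAdDiagonalizable K a
  grade_zero : grade K a 0 = H.toSubmodule
  one_le : 1 ≤ M
  exists_int : ∀ μ, grade K a μ ≠ ⊥ → ∃ k : ℤ, -M ≤ k ∧ k ≤ M ∧ μ = ((2 * k : ℤ) : K)
  ne_bot : grade K a ((2 * M : ℤ) : K) ≠ ⊥
  eq_zero_of_grade_zero : ∀ x ∈ grade K a 0, ⁅e, x⁆ = 0 → x = 0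
  exists_smul_of_grade_two : ∀ x ∈ grade K a 2, ⁅e, x⁆ = 0 → ∃ c : K, x = c • e

section Chevalley

variable [IsKilling K g] {H : LieSubalgebra K g} [H.IsCartanSubalgebra] (b : (rootSystem H).Base)
  {e f : H.root → g} (he : ∀ i, e i ∈ rootSpace H i.1) (hf : ∀ i, f i ∈ rootSpace H (-i.1))
  (hef : ∀ i, ⁅e i, f i⁆ = (coroot i.1 : g))

include he hf in
lemma lie_rootVector_eq_zero_of_ne {i j : H.root} (hi : i ∈ b.support) (hj : j ∈ b.support)
    (hij : i ≠ j) : ⁅e i, f j⁆ = 0 := by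
  by_contra h
  obtain ⟨k, hk⟩ := exists_root_eq_sub_of_lie_ne_zero hij (he i) (hf j) h
  exact b.sub_notMem_range_root hi hj ⟨k, hk⟩

include he hf hef in
lemma lie_sum_smul_rootVector (c : H.root → K) {j : H.root} (hj : j ∈ b.support) :
    ⁅∑ i ∈ b.support, c i • e i, f j⁆ = c j • (coroot j.1 : g) := by
  rw [sum_lie, Finset.sum_eq_single_of_mem j hj]
  · rw [smul_lie, hef]
  · intro i hi hij
    rw [smul_lie, lie_rootVector_eq_zero_of_ne b he hf hi hj hij, smul_zero]

include he hf hef in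
lemma eq_zero_of_sum_smul_rootVector_eq_zero {c : H.root → K}
    (h : ∑ i ∈ b.support, c i • e i = 0) {j : H.root} (hj : j ∈ b.support) : c j = 0 := by
  have := lie_sum_smul_rootVector b he hf hef c hj
  rw [h, zero_lie, eq_comm, smul_eq_zero] at this
  exact this.resolve_right (coroot_coe_ne_zero j)

include he in
lemma lie_cartan_sum_smul_rootVector (c : H.root → K) (u : H) :
    ⁅(u : g), ∑ i ∈ b.support, c i • e i⁆ = ∑ i ∈ b.support, (i.1 u * c i) • e i := by
  rw [lie_sum]
  refine Finset.sum_congr rfl fun i _ ↦ ?_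
  rw [lie_smul, mul_comm, mul_smul]
  congr 1
  exact lie_eq_smul_of_mem_rootSpace (he i) u

end Chevalley
end LieAlgebra

namespace LieAlgebra

open Module IsKilling

variable {K g : Type*} [Field K] [CharZero K] [IsAlgClosed K] [LieRing g] [LieAlgebra K g]
  [FiniteDimensional K g]

section

variable [IsKilling K g] {H : LieSubalgebra K g} [H.IsCartanSubalgebra] (b : (rootSystem H).Base)
  {a : H} (ha : ∀ i ∈ b.support, i.1 a = 2)
include ha

lemma exists_height_eq_of_weight (α : LieModule.Weight K H g) (hα : α.IsNonZero) :
    ∃ i : H.root, i.1 = α ∧ α a = ((2 * b.height i : ℤ) : K) :=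
  ⟨⟨α, by simpa [LieSubalgebra.root] using hα⟩, rfl,
    apply_eq_two_mul_height b ha ⟨α, by simpa [LieSubalgebra.root] using hα⟩⟩

lemma grade_zero_eq_cartan : grade K (a : g) 0 = H.toSubmodule := by
  refine le_antisymm (fun x hx ↦ ?_) fun x hx ↦ mem_grade_zero_of_mem_cartan a.2 hx
  refine mem_of_mem_grade_of_forall_rootSpace_le a (fun _ ↦ le_rfl) (fun α hα h0 ↦ ?_) hx
  obtain ⟨i, rfl, hi⟩ := exists_height_eq_of_weight b ha α hα
  rw [hi] at h0
  have h1 : b.height i = 0 := by simpa using h0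
  exact absurd h1 (b.height_ne_zero i)

lemma exists_height_eq_of_grade_ne_bot {μ : K} (h : grade K (a : g) μ ≠ ⊥) :
    μ = 0 ∨ ∃ i : H.root, μ = ((2 * b.height i : ℤ) : K) := by
  by_contra! hc
  refine h ((Submodule.eq_bot_iff _).2 fun x hx ↦ ?_)
  refine (Submodule.mem_bot K).1 <| mem_of_mem_grade_of_forall_rootSpace_le a
    (fun h0 ↦ absurd h0 hc.1) (fun α hα h0 ↦ ?_) hx
  obtain ⟨i, -, hi⟩ := exists_height_eq_of_weight b ha α hα
  exact absurd (h0 ▸ hi) (hc.2 i)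

omit ha in
variable (a) in
lemma isAdDiagonalizable_of_mem_cartan : IsAdDiagonalizable K (a : g) := by
  intro μ x hx
  have : x ∈ (ad K g a).eigenspace μ := by
    refine mem_of_mem_grade_of_forall_rootSpace_le a (fun h0 y hy ↦ ?_) (fun α hα h0 y hy ↦ ?_) hx
    · rw [End.mem_eigenspace_iff, h0, zero_smul]
      exact lie_eq_zero_of_mem_cartan a.2 hy
    · rw [End.mem_eigenspace_iff, ← h0]
      exact lie_eq_smul_of_mem_rootSpace hy a
  exact End.mem_eigenspace_iff.1 this

lemma grade_two_le_span {e : H.root → g} (he : ∀ i, e i ∈ rootSpace H i.1) (he0 : ∀ i, e i ≠ 0) :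
    grade K (a : g) 2 ≤ Submodule.span K (e '' b.support) := by
  intro x hx
  refine mem_of_mem_grade_of_forall_rootSpace_le a (fun h0 ↦ by simp at h0)
    (fun α hα h0 y hy ↦ ?_) hx
  obtain ⟨i, rfl, hi⟩ := exists_height_eq_of_weight b ha α hα
  have h1 : b.height i = 1 := by
    rw [h0] at hi
    have : (2 * b.height i : ℤ) = 2 := by exact_mod_cast hi.symm
    omega
  obtain ⟨c, rfl⟩ := exists_eq_smul_of_mem_rootSpace hα (he i) (he0 i) hy
  exact Submodule.smul_mem _ _
    (Submodule.subset_span ⟨i, b.mem_support_of_height_eq_one h1, rfl⟩)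

end

variable [IsSimple K g] {H : LieSubalgebra K g} [H.IsCartanSubalgebra]

theorem exists_isPrincipalGrading (b : (rootSystem H).Base) {θ : H.root} {M : ℕ}
    (hθ : b.height θ = M) (hmax : ∀ i, b.height i ≤ M) :
    ∃ e y a : g, IsPrincipalGrading H e y a M := by
  classical
  obtain ⟨e, f, he, hf, he0, hef⟩ := exists_rootVectors H
  obtain ⟨a, ha⟩ := exists_forall_mem_support_apply_eq b fun _ ↦ 2
  have hbound (i : H.root) : -(M : ℤ) ≤ b.height i := by
    let := (rootSystem H).indexNeg
    have := b.height_reflectionPerm_self i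
    have := hmax (-i)
    omega
  have hne : Nonempty H.root := ⟨θ⟩
  have h_int (μ : K) (h : grade K (a : g) μ ≠ ⊥) :
      ∃ k : ℤ, -M ≤ k ∧ k ≤ M ∧ μ = ((2 * k : ℤ) : K) := by
    rcases exists_height_eq_of_grade_ne_bot b ha h with rfl | ⟨i, hi⟩
    · exact ⟨0, by omega, by omega, by simp⟩
    · exact ⟨_, hbound i, hmax i, hi⟩
  set E := ∑ i ∈ b.support, (1 : K) • e i with hE
  have hEa : ⁅(a : g), E⁆ = (2 : K) • E := by
    rw [hE, lie_cartan_sum_smul_rootVector b he, Finset.smul_sum]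
    exact Finset.sum_congr rfl fun i hi ↦ by rw [ha i hi, smul_smul]
  have hE2 : E ∈ grade K (a : g) 2 := mem_grade_of_lie_eq hEa
  have hpow (n : ℕ) {μ : K} {x : g} (hx : x ∈ grade K (a : g) μ) :
      (ad K g E ^ n) x ∈ grade K (a : g) (μ + 2 * n) := by
    induction n with
    | zero => simpa using hx
    | succ n ih =>
      have := lie_mem_grade hE2 ih
      rw [pow_succ', Module.End.mul_apply, ad_apply]
      convert this using 1
      push_cast; ring_nf
  have hnil : IsNilpotent (ad K g E) := by
    refine ⟨2 * M + 1, linearMap_ext_maxGenEigenspace (ad K g a) fun μ x hx ↦ ?_⟩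
    rw [LinearMap.zero_apply]
    by_contra h0
    have h1 : grade K (a : g) μ ≠ ⊥ := fun h ↦ h0 (by
      have : x = 0 := by simpa [h] using hx
      simp [this])
    have h2 : grade K (a : g) (μ + 2 * (2 * M + 1 : ℕ)) ≠ ⊥ := fun h ↦ h0 (by
      simpa only [h, Submodule.mem_bot] using hpow (2 * M + 1) hx)
    obtain ⟨k, hk, -, rfl⟩ := h_int _ h1
    obtain ⟨l, -, hl, h⟩ := h_int _ h2
    have : 2 * k + 2 * (2 * M + 1) = 2 * l := by exact_mod_cast h
    omega
  obtain ⟨d, hd⟩ : ∃ d : H.root → K, a = ∑ i ∈ b.support, d i • coroot i.1 := by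
    refine ⟨fun i ↦ if hi : i ∈ b.support then b.toCoweightBasis.repr a ⟨i, hi⟩ else 0, ?_⟩
    rw [← Finset.sum_coe_sort]
    conv_lhs => rw [← b.toCoweightBasis.sum_repr a]
    exact Finset.sum_congr rfl fun i _ ↦ by simp
  have hlie : ⁅E, ∑ i ∈ b.support, d i • f i⁆ = a := by
    rw [lie_sum, hd, AddSubmonoidClass.coe_finsetSum]
    refine Finset.sum_congr rfl fun i hi ↦ ?_
    rw [lie_smul, lie_sum_smul_rootVector b he hf hef _ hi, one_smul]
    rfl
  refine ⟨E, _, a, ⟨hnil, hlie, hEa⟩, isAdDiagonalizable_of_mem_cartan a, grade_zero_eq_cartan b ha,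
    ?_, h_int, ?_, fun x hx hx0 ↦ ?_, fun x hx hx0 ↦ ?_⟩
  · obtain ⟨i, hi⟩ := b.support_nonempty
    have := b.height_one_of_mem_support hi
    have := hmax i
    omega
  · refine (Submodule.ne_bot_iff _).2 ⟨e θ, mem_grade_of_lie_eq ?_, he0 θ⟩
    rw [← hθ, ← apply_eq_two_mul_height b ha]
    exact lie_eq_smul_of_mem_rootSpace (he θ) a
  · rw [grade_zero_eq_cartan b ha] at hx
    lift x to H using hx
    rw [← lie_skew, neg_eq_zero, hE, lie_cartan_sum_smul_rootVector b he] at hx0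
    have := eq_zero_of_forall_mem_support_apply_eq_zero b (u := x) fun i hi ↦ by
      simpa using eq_zero_of_sum_smul_rootVector_eq_zero b he hf hef hx0 hi
    simp [this]
  · obtain ⟨c, rfl⟩ := (Submodule.mem_span_image_finset_iff_exists_fun' K).1
      (grade_two_le_span b ha he he0 hx)
    have key {i k : H.root} (hi : i ∈ b.support) (hk : k ∈ b.support) :
        i.1 (coroot k.1) * (c k - c i) = 0 := by
      have h1 : c k • ⁅(coroot k.1 : g), E⁆ = ⁅(coroot k.1 : g), ∑ i ∈ b.support, c i • e i⁆ := by
        have := leibniz_lie E (∑ i ∈ b.support, c i • e i) (f k)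
        rw [hx0, lie_sum_smul_rootVector b he hf hef _ hk, hE,
          lie_sum_smul_rootVector b he hf hef _ hk, zero_lie, zero_add, lie_smul, one_smul] at this
        rw [← hE] at this
        rw [← lie_skew, smul_neg, this, lie_skew]
      rw [hE, lie_cartan_sum_smul_rootVector b he, lie_cartan_sum_smul_rootVector b he,
        Finset.smul_sum, ← sub_eq_zero, ← Finset.sum_sub_distrib] at h1
      simp only [smul_smul, ← sub_smul] at h1
      have := eq_zero_of_sum_smul_rootVector_eq_zero b he hf hef h1 hi
      linear_combination this
    obtain ⟨i₀, hi₀⟩ := b.support_nonempty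
    refine ⟨c i₀, ?_⟩
    rw [hE, Finset.smul_sum]
    refine Finset.sum_congr rfl fun i hi ↦ ?_
    have := b.mem_of_forall_pairing_eq_zero (J := {i | i ∈ b.support ∧ c i = c i₀})
      (fun i hi ↦ hi.1) ⟨i₀, hi₀, rfl⟩ (fun i hi k hk hk' ↦ ?_) hi
    · rw [this.2, one_smul]
    · rw [rootSystem_pairing_apply]
      refine (mul_eq_zero.1 (key hi.1 hk)).resolve_right fun h ↦ hk' ⟨hk, ?_⟩
      rw [sub_eq_zero.1 h, hi.2]

end LieAlgebra

namespace Module.End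

open Polynomial

variable {K V : Type*} [Field K] [IsAlgClosed K] [CharZero K] [AddCommGroup V] [Module K V]
  [FiniteDimensional K V]

/-- If an injective endomorphism multiplies the eigenvalues of an automorphism of order `n` by a
primitive `n`-th root of unity, then all eigenspaces of the automorphism have the same dimension. -/
lemma finrank_eq_mul_finrank_eigenspace_one {n : ℕ} (hn : n ≠ 0) {ζ : K} (hζ : IsPrimitiveRoot ζ n)
    {σ F : End K V} (hσ : σ ^ n = 1) (hF : Function.Injective F) (h : σ * F = ζ • (F * σ)) :
    finrank K V = n * finrank K (σ.eigenspace 1) := by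
  have : NeZero n := ⟨hn⟩
  have hss : σ.IsSemisimple := by
    have : (X ^ n - 1 : K[X]).Separable := by
      simpa using separable_X_pow_sub_C (1 : K) (n := n) (by simpa) one_ne_zero
    exact isSemisimple_of_squarefree_aeval_eq_zero this.squarefree (by simp [hσ])
  have hmem {μ : K} {x : V} (hx : x ∈ σ.eigenspace μ) : F x ∈ σ.eigenspace (ζ * μ) := by
    rw [mem_eigenspace_iff] at hx ⊢
    have := LinearMap.congr_fun h x
    simp only [mul_apply, LinearMap.smul_apply, hx, map_smul] at this
    rw [this, smul_smul]
  have hle (μ : K) : finrank K (σ.eigenspace μ) ≤ finrank K (σ.eigenspace (ζ * μ)) :=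
    LinearMap.finrank_le_finrank_of_injective (f := F.restrict fun x hx ↦ hmem hx)
      fun x y hxy ↦ Subtype.ext (hF (congrArg Subtype.val hxy))
  have hmono : Monotone fun j : ℕ ↦ finrank K (σ.eigenspace (ζ ^ j)) :=
    monotone_nat_of_le_succ fun j ↦ (hle (ζ ^ j)).trans_eq (by rw [pow_succ'])
  have hconst (j : Fin n) :
    finrank K (σ.eigenspace (ζ ^ (j : ℕ))) = finrank K (σ.eigenspace 1) := by
    refine le_antisymm ?_ ?_
    · exact (hmono j.2.le).trans_eq (by beta_reduce; rw [hζ.pow_eq_one])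
    · exact Eq.trans_le (by beta_reduce; rw [pow_zero]) (hmono (Nat.zero_le j))
  have hind : iSupIndep fun j : Fin n ↦ σ.eigenspace (ζ ^ (j : ℕ)) :=
    σ.eigenspaces_iSupIndep.comp fun i j hij ↦ Fin.ext (hζ.pow_inj i.2 j.2 hij)
  have htop : ⨆ j : Fin n, σ.eigenspace (ζ ^ (j : ℕ)) = ⊤ := by
    rw [eq_top_iff, ← iSup_maxGenEigenspace_eq_top σ]
    refine iSup_le fun μ ↦ ?_
    rw [hss.isFinitelySemisimple.maxGenEigenspace_eq_eigenspace]
    rcases eq_or_ne (σ.eigenspace μ) ⊥ with h0 | h0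
    · simp [h0]
    · obtain ⟨x, hx, hx0⟩ := (Submodule.ne_bot_iff _).1 h0
      have h1 : μ ^ n = 1 := by
        have := HasEigenvector.pow_apply (f := σ) (μ := μ) ⟨hx, hx0⟩ n
        rw [hσ, one_apply] at this
        have h2 : (1 - μ ^ n) • x = 0 := by rw [sub_smul, one_smul, ← this, sub_self]
        exact (sub_eq_zero.1 ((smul_eq_zero.1 h2).resolve_right hx0)).symm
      obtain ⟨i, hi, rfl⟩ := hζ.eq_pow_of_pow_eq_one h1
      exact le_iSup (fun j : Fin n ↦ σ.eigenspace (ζ ^ (j : ℕ))) ⟨i, hi⟩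
  have h_int := DirectSum.isInternal_submodule_of_iSupIndep_of_iSup_eq_top hind htop
  rw [← (LinearEquiv.ofBijective (DirectSum.coeLinearMap _) h_int).finrank_eq,
    Module.finrank_directSum]
  simp [hconst]

end Module.End

namespace LieAlgebra.IsPrincipalGrading

open Module IsKilling Module.End

variable {K g : Type*} [Field K] [CharZero K] [IsAlgClosed K] [LieRing g] [LieAlgebra K g]
  [FiniteDimensional K g] {H : LieSubalgebra K g} {e y a x₀ : g} {M : ℕ}
  (p : IsPrincipalGrading H e y a M)

variable (K a) in
/-- The projection onto the elements of height `k`. -/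
noncomputable def proj (k : ℤ) : End K g := genProj (ad K g a) ((2 * k : ℤ) : K)

omit [IsAlgClosed K] in
lemma cast_two_mul_ne {k l : ℤ} (h : k ≠ l) : ((2 * k : ℤ) : K) ≠ ((2 * l : ℤ) : K) := by
  intro h'
  exact h (by have : 2 * k = 2 * l := by exact_mod_cast h'
              omega)

omit [CharZero K] in
lemma proj_mem (k : ℤ) (x : g) : proj K a k x ∈ grade K a ((2 * k : ℤ) : K) := genProj_mem _ _ x

omit [CharZero K] in
lemma proj_of_mem {k : ℤ} {x : g} (h : x ∈ grade K a ((2 * k : ℤ) : K)) : proj K a k x = x :=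
  genProj_of_mem h

lemma proj_of_mem_of_ne {k l : ℤ} {x : g} (h : x ∈ grade K a ((2 * l : ℤ) : K)) (hkl : k ≠ l) :
    proj K a k x = 0 :=
  genProj_of_mem_of_ne h (cast_two_mul_ne hkl)

omit [CharZero K] in
lemma proj_zero_mem (x : g) : proj K a 0 x ∈ grade K a 0 := by
  have := proj_mem (K := K) (a := a) 0 x
  rwa [mul_zero, Int.cast_zero] at this

omit [CharZero K] in
lemma proj_one_mem (x : g) : proj K a 1 x ∈ grade K a 2 := by
  have := proj_mem (K := K) (a := a) 1 x
  rwa [mul_one, Int.cast_ofNat] at this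

omit [CharZero K] in
lemma proj_add_lie {l : ℤ} (hx : x₀ ∈ grade K a ((2 * l : ℤ) : K)) (k : ℤ) (x : g) :
    proj K a (k + l) ⁅x₀, x⁆ = ⁅x₀, proj K a k x⁆ := by
  have := genProj_lie (μ := ((2 * k : ℤ) : K)) hx x
  rwa [← Int.cast_add, ← mul_add] at this

include p

lemma proj_eq_zero {k : ℤ} (hk : k < -M ∨ M < k) (x : g) : proj K a k x = 0 := by
  by_contra h
  obtain ⟨l, hl, hl', heq⟩ := p.exists_int ((2 * k : ℤ) : K)
    ((Submodule.ne_bot_iff _).2 ⟨_, proj_mem k x, h⟩)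
  have : k ≠ l := by omega
  exact cast_two_mul_ne this heq

omit [CharZero K] in
lemma eq_zero_of_forall_proj {x : g} (h : ∀ k : ℤ, proj K a k x = 0) : x = 0 := by
  refine eq_zero_of_forall_genProj_eq_zero (ad K g a) fun μ ↦ ?_
  by_contra h0
  obtain ⟨k, -, -, rfl⟩ := p.exists_int μ
    ((Submodule.ne_bot_iff _).2 ⟨_, genProj_mem (ad K g a) μ x, h0⟩)
  exact h0 (h k)

omit [CharZero K] [IsAlgClosed K] [FiniteDimensional K g] in
lemma mem_grade_two : e ∈ grade K a ((2 * 1 : ℤ) : K) := by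
  rw [mul_one, Int.cast_ofNat]
  exact p.halfTriple.mem_grade

omit [CharZero K] in
lemma proj_lie_add (hx : x₀ ∈ grade K a ((2 * -M : ℤ) : K)) (k : ℤ) (x : g) :
    proj K a (k + 1) ⁅e + x₀, x⁆ = ⁅e, proj K a k x⁆ + ⁅x₀, proj K a (k + 1 + M) x⁆ := by
  rw [add_lie, map_add, proj_add_lie p.mem_grade_two, ← proj_add_lie hx, add_neg_cancel_right]

lemma lie_proj_eq_zero (hx : x₀ ∈ grade K a ((2 * -M : ℤ) : K)) {x : g} (h : ⁅e + x₀, x⁆ = 0)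
    {k : ℤ} (hk : 0 ≤ k) : ⁅e, proj K a k x⁆ = 0 := by
  have := p.proj_lie_add hx k x
  rw [h, p.proj_eq_zero (k := k + 1 + M) (by omega)] at this
  simpa using this.symm

lemma proj_zero_eq_zero (hx : x₀ ∈ grade K a ((2 * -M : ℤ) : K)) {x : g} (h : ⁅e + x₀, x⁆ = 0) :
    proj K a 0 x = 0 :=
  p.eq_zero_of_grade_zero _ (proj_zero_mem x) (p.lie_proj_eq_zero hx h le_rfl)

lemma eq_zero_of_lie_eq_zero_of_proj (hx : x₀ ∈ grade K a ((2 * -M : ℤ) : K)) {x : g}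
    (h : ⁅e + x₀, x⁆ = 0) (h0 : ∀ k : ℤ, 0 < k → proj K a k x = 0) : x = 0 := by
  refine p.eq_zero_of_forall_proj fun k ↦ ?_
  rcases lt_trichotomy 0 k with hk | rfl | hk
  · exact h0 k hk
  · exact p.proj_zero_eq_zero hx h
  · by_cases hkM : k < -M
    · exact p.proj_eq_zero (.inl hkM) x
    have := p.proj_lie_add hx k x
    rw [h, h0 (k + 1 + M) (by omega), lie_zero, add_zero, map_zero] at this
    exact p.halfTriple.eq_zero_of_lie_eq_zero_of_mem_grade (m := 2 * k) (by omega)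
      (proj_mem k x) this.symm

lemma exists_eq_smul_of_lie_eq_zero (hx : x₀ ∈ grade K a ((2 * -M : ℤ) : K)) {x : g}
    (h : ⁅e + x₀, x⁆ = 0) (h0 : ∀ k : ℤ, 1 < k → proj K a k x = 0) :
    ∃ c : K, x = c • (e + x₀) := by
  obtain ⟨c, hc⟩ := p.exists_smul_of_grade_two _ (proj_one_mem x)
    (p.lie_proj_eq_zero hx h zero_le_one)
  refine ⟨c, sub_eq_zero.1 <| p.eq_zero_of_lie_eq_zero_of_proj hx
    (by rw [lie_sub, h, lie_smul, lie_self, smul_zero, sub_zero]) fun k hk ↦ ?_⟩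
  have h1 := p.one_le
  have hx0 : proj K a k x₀ = 0 := proj_of_mem_of_ne hx (by omega)
  have he : proj K a 1 e = e := proj_of_mem p.mem_grade_two
  rcases eq_or_ne k 1 with rfl | hk1
  · rw [map_sub, map_smul, map_add, hx0, he, hc, add_zero, sub_self]
  · have he0 : proj K a k e = 0 := proj_of_mem_of_ne p.mem_grade_two hk1
    rw [map_sub, map_smul, map_add, hx0, he0, h0 k (by omega)]
    simp

lemma finrank_ker_le [IsKilling K g] (hx : x₀ ∈ grade K a ((2 * -M : ℤ) : K)) :
    finrank K (LinearMap.ker (ad K g (e + x₀))) ≤ finrank K H := by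
  have hker : finrank K (LinearMap.ker (ad K g e)) = finrank K H := by
    rw [p.halfTriple.finrank_ker_ad, p.grade_zero]
    have : grade K a (-1) = ⊥ := by
      by_contra h
      obtain ⟨k, -, -, hk⟩ := p.exists_int _ h
      have : (-1 : ℤ) = 2 * k := by exact_mod_cast hk
      omega
    rw [this, finrank_bot]
    rfl
  rw [← hker]
  let T : End K g := ∑ k ∈ Finset.Icc (0 : ℤ) M, proj K a k
  have hT (x : g) : T x = ∑ k ∈ Finset.Icc (0 : ℤ) M, proj K a k x := by simp [T]
  refine LinearMap.finrank_le_finrank_of_injective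
    (f := T.restrict (p := LinearMap.ker (ad K g (e + x₀))) (q := LinearMap.ker (ad K g e))
      fun x h ↦ ?_) ?_
  · rw [LinearMap.mem_ker, hT, map_sum]
    exact Finset.sum_eq_zero fun k hk ↦ p.lie_proj_eq_zero hx (by simpa using h)
      (Finset.mem_Icc.1 hk).1
  · rw [← LinearMap.ker_eq_bot, LinearMap.ker_eq_bot']
    rintro ⟨x, h⟩ hT0
    replace hT0 : T x = 0 := congrArg Subtype.val hT0
    refine Subtype.ext (p.eq_zero_of_lie_eq_zero_of_proj hx (by simpa using h) fun k hk ↦ ?_)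
    by_cases hkM : M < k
    · exact p.proj_eq_zero (.inr hkM) x
    have := congrArg (proj K a k) hT0
    rw [hT, map_sum, Finset.sum_eq_single_of_mem k (Finset.mem_Icc.2 ⟨hk.le, by omega⟩)
      fun l _ hl ↦ proj_of_mem_of_ne (proj_mem l x) hl.symm, proj_of_mem (proj_mem k x),
      map_zero] at this
    exact this

lemma cartan_le_range [IsKilling K g] (hx : x₀ ∈ grade K a ((2 * -M : ℤ) : K)) :
    H.toSubmodule ≤ LinearMap.range (ad K g (e + x₀)) := by
  intro u hu
  refine mem_range_ad_of_killingForm_eq_zero fun w hw ↦ ?_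
  rw [← p.grade_zero] at hu
  rw [LieModule.traceForm_comm]
  have := killingForm_genProj (a := a) w hu
  have h0 := p.proj_zero_eq_zero hx hw
  simp only [proj, mul_zero, Int.cast_zero] at h0
  rw [neg_zero, h0, map_zero, LinearMap.zero_apply] at this
  exact this.symm

lemma not_isNilpotent_ad_add [IsKilling K g] (hx : x₀ ∈ grade K a ((2 * -M : ℤ) : K))
    (hx0 : x₀ ≠ 0) :
    ¬ IsNilpotent (ad K g (e + x₀)) := by
  intro hN
  obtain ⟨y', a', ht⟩ := exists_isHalfTriple hN
  have h1 := p.one_le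
  have hz : ⁅e + x₀, a'⁆ = (-2 : K) • (e + x₀) := by rw [← lie_skew, ht.lie_self, neg_smul]
  have he : proj K a 1 e = e := proj_of_mem p.mem_grade_two
  have he' : proj K a (-M) e = 0 := proj_of_mem_of_ne p.mem_grade_two (by omega)
  have hx' : proj K a 1 x₀ = 0 := proj_of_mem_of_ne hx (by omega)
  have hx'' : proj K a (-M) x₀ = x₀ := proj_of_mem hx
  have hu : proj K a 0 a' = a := by
    have := p.proj_lie_add hx 0 a'
    rw [hz, p.proj_eq_zero (k := 0 + 1 + M) (by omega), lie_zero, add_zero, map_smul, map_add,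
      zero_add, he, hx', add_zero] at this
    refine sub_eq_zero.1 (p.eq_zero_of_grade_zero _
      (sub_mem (proj_zero_mem a') (self_mem_grade_zero a)) ?_)
    rw [lie_sub, ← this, ← lie_skew, p.halfTriple.lie_self]
    module
  have := p.proj_lie_add hx (-M - 1) a'
  rw [hz, p.proj_eq_zero (k := -M - 1) (by omega), lie_zero, zero_add, map_smul, map_add,
    show (-M - 1 + 1 : ℤ) = -M by ring, he', hx'', zero_add, show (-M + M : ℤ) = 0 by ring, hu,
    ← lie_skew, p.diag _ _ hx, ← neg_smul] at this
  have h2 : ((-2 : ℤ) : K) = ((-(2 * -M) : ℤ) : K) := by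
    simpa using smul_left_injective K hx0 this
  have : (-2 : ℤ) = -(2 * -M) := by exact_mod_cast h2
  omega

end LieAlgebra.IsPrincipalGrading

namespace LieAlgebra.IsPrincipalGrading

open Module IsKilling Module.End

variable {K g : Type*} [Field K] [CharZero K] [IsAlgClosed K] [LieRing g] [LieAlgebra K g]
  [FiniteDimensional K g] {H : LieSubalgebra K g} {e y a x₀ : g} {M : ℕ} {ζ : K}
  (p : IsPrincipalGrading H e y a M)

variable (a M ζ) in
/-- The automorphism acting on the elements of height `k` by `ζ ^ k`. -/
noncomputable def rot : End K g := ∑ k ∈ Finset.Icc (-M : ℤ) M, ζ ^ k • proj K a k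

include p

omit [CharZero K] in
lemma homogeneous_induction {q : g → Prop} (x : g)
    (mem : ∀ k : ℤ, ∀ x ∈ grade K a ((2 * k : ℤ) : K), q x)
    (add : ∀ x y, q x → q y → q (x + y)) : q x := by
  refine maxGenEigenspace_induction (p := q) (ad K g a) x (fun μ x hx ↦ ?_) add
  by_cases h : grade K a μ = ⊥
  · obtain rfl : x = 0 := (Submodule.eq_bot_iff _).1 h x hx
    exact mem 0 0 (zero_mem _)
  · obtain ⟨k, -, -, rfl⟩ := p.exists_int μ h
    exact mem k x hx

lemma rot_of_mem {k : ℤ} {x : g} (hx : x ∈ grade K a ((2 * k : ℤ) : K)) :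
    rot a M ζ x = ζ ^ k • x := by
  rw [rot, LinearMap.sum_apply]
  by_cases hk : k ∈ Finset.Icc (-M : ℤ) M
  · rw [Finset.sum_eq_single_of_mem k hk, LinearMap.smul_apply, proj_of_mem hx]
    intro l _ hl
    rw [LinearMap.smul_apply, proj_of_mem_of_ne hx hl, smul_zero]
  · have : x = 0 := by
      rw [← proj_of_mem hx]
      refine p.proj_eq_zero ?_ x
      rw [Finset.mem_Icc] at hk
      omega
    simp [this]

lemma rot_lie (hζ : ζ ≠ 0) (x y : g) : rot a M ζ ⁅x, y⁆ = ⁅rot a M ζ x, rot a M ζ y⁆ := by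
  refine p.homogeneous_induction (q := fun x ↦ rot a M ζ ⁅x, y⁆ = ⁅rot a M ζ x, rot a M ζ y⁆) x
    (fun k x hx ↦ ?_) fun x x' h h' ↦ by simp only [add_lie, map_add, h, h']
  refine p.homogeneous_induction (q := fun y ↦ rot a M ζ ⁅x, y⁆ = ⁅rot a M ζ x, rot a M ζ y⁆) y
    (fun l y hy ↦ ?_) fun x x' h h' ↦ by simp only [lie_add, map_add, h, h']
  have : ⁅x, y⁆ ∈ grade K a ((2 * (k + l) : ℤ) : K) := by
    rw [mul_add, Int.cast_add]
    exact lie_mem_grade hx hy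
  rw [p.rot_of_mem this, p.rot_of_mem hx, p.rot_of_mem hy, smul_lie, lie_smul, smul_smul,
    zpow_add₀ hζ]

lemma proj_rot (k : ℤ) (x : g) : proj K a k (rot a M ζ x) = ζ ^ k • proj K a k x := by
  refine p.homogeneous_induction (q := fun x ↦ proj K a k (rot a M ζ x) = ζ ^ k • proj K a k x) x
    (fun l x hx ↦ ?_) fun x x' h h' ↦ by simp only [smul_add, map_add, h, h']
  rw [p.rot_of_mem hx, map_smul]
  by_cases h : k = l
  · rw [h]
  · rw [proj_of_mem_of_ne hx h, smul_zero, smul_zero]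

lemma rot_pow {n : ℕ} (hζ : ζ ^ n = 1) : rot a M ζ ^ n = 1 := by
  ext x
  refine p.homogeneous_induction (q := fun x ↦ (rot a M ζ ^ n) x = x) x
    (fun l x hx ↦ ?_) fun x x' h h' ↦ by rw [map_add, h, h']
  have (m : ℕ) : (rot a M ζ ^ m) x = (ζ ^ l) ^ m • x := by
    induction m with
    | zero => simp
    | succ m ih => rw [pow_succ', mul_apply, ih, map_smul, p.rot_of_mem hx, smul_smul, ← pow_succ]
  rw [this, ← zpow_natCast, ← zpow_mul, mul_comm, zpow_mul, zpow_natCast, hζ, one_zpow, one_smul]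

lemma proj_eq_zero_of_rot_eq (hζ : IsPrimitiveRoot ζ (M + 1)) {m : ℤ} {x : g}
    (hx : rot a M ζ x = ζ ^ m • x) {k : ℤ} (hk : ¬ ((M + 1 : ℕ) : ℤ) ∣ k - m) :
    proj K a k x = 0 := by
  have := p.proj_rot (ζ := ζ) k x
  have h0 : ζ ≠ 0 := hζ.ne_zero (by omega)
  rw [hx, map_smul, ← sub_eq_zero, ← sub_smul] at this
  refine (smul_eq_zero.1 this).resolve_left fun h ↦ hk ?_
  rw [← hζ.zpow_eq_one_iff_dvd, zpow_sub₀ h0, sub_eq_zero.1 h, div_self (zpow_ne_zero _ h0)]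

lemma mem_cartan_iff (hζ : IsPrimitiveRoot ζ (M + 1)) (x : g) : rot a M ζ x = x ↔ x ∈ H := by
  rw [← LieSubalgebra.mem_toSubmodule, ← p.grade_zero]
  constructor
  · intro h
    have : proj K a 0 x = x := by
      rw [← sub_eq_zero]
      refine p.eq_zero_of_forall_proj fun k ↦ ?_
      rw [map_sub]
      by_cases hk : k = 0
      · rw [hk, proj_of_mem (proj_mem 0 x), sub_self]
      · rw [proj_of_mem_of_ne (proj_mem 0 x) hk, zero_sub, neg_eq_zero]
        by_cases hkM : k < -M ∨ M < k
        · exact p.proj_eq_zero hkM x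
        refine p.proj_eq_zero_of_rot_eq hζ (m := 0) (by simpa using h) fun hd ↦ ?_
        have := Int.le_of_dvd (abs_pos.2 hk) ((dvd_abs _ _).2 (by simpa using hd))
        rcases abs_cases k <;> omega
    rw [← this]
    exact proj_zero_mem x
  · intro h
    have := p.rot_of_mem (ζ := ζ) (k := 0) (x := x)
      (by simpa only [mul_zero, Int.cast_zero] using h)
    simpa using this

lemma rot_add (hζ : IsPrimitiveRoot ζ (M + 1)) (hx : x₀ ∈ grade K a ((2 * -M : ℤ) : K)) :
    rot a M ζ (e + x₀) = ζ • (e + x₀) := by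
  have h0 : ζ ≠ 0 := hζ.ne_zero (by omega)
  have h1 : ζ ^ (-M : ℤ) = ζ := by
    have : ζ ^ (-M : ℤ) = ζ ^ (1 - ((M + 1 : ℕ) : ℤ)) := by congr 1; push_cast; ring
    rw [this, zpow_sub₀ h0, zpow_one, zpow_natCast, hζ.pow_eq_one, div_one]
  rw [map_add, p.rot_of_mem hx, p.rot_of_mem p.mem_grade_two, h1, zpow_one, smul_add]

lemma rot_surjective (hζ : IsPrimitiveRoot ζ (M + 1)) : Function.Surjective (rot a M ζ) := by
  intro x
  refine ⟨(rot a M ζ ^ M) x, ?_⟩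
  have := LinearMap.congr_fun (p.rot_pow hζ.pow_eq_one) x
  rwa [pow_succ'] at this

variable [IsKilling K g]

lemma isAdDiagonalizable_add (hx : x₀ ∈ grade K a ((2 * -M : ℤ) : K)) (hx0 : x₀ ≠ 0) :
    IsAdDiagonalizable K (e + x₀) := by
  obtain ⟨s, hs⟩ := exists_forall_mem_grade_lie_eq_smul (K := K) (e + x₀)
  obtain ⟨ζ, hζ⟩ := HasEnoughRootsOfUnity.exists_primitiveRoot K (M + 1)
  have h0 : ζ ≠ 0 := hζ.ne_zero (by omega)
  have hM := p.one_le
  set σ := rot a M ζ with hσ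
  have hgrade {μ : K} {x : g} (h : x ∈ grade K (e + x₀) μ) : σ x ∈ grade K (e + x₀) (ζ⁻¹ * μ) := by
    obtain ⟨n, hn⟩ := (mem_maxGenEigenspace _ _ _).1 h
    refine (mem_maxGenEigenspace _ _ _).2 ⟨n, ?_⟩
    have key (m : ℕ) : ((ad K g (e + x₀) - (ζ⁻¹ * μ) • 1) ^ m) (σ x) =
        (ζ⁻¹) ^ m • σ (((ad K g (e + x₀) - μ • 1) ^ m) x) := by
      induction m with
      | zero => simp
      | succ m ih =>
        rw [pow_succ', mul_apply, ih, pow_succ' (ad K g (e + x₀) - μ • 1), mul_apply]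
        simp only [LinearMap.sub_apply, LinearMap.smul_apply, one_apply, ad_apply, map_sub,
          map_smul]
        rw [p.rot_lie h0, p.rot_add hζ hx, smul_lie, ← hσ]
        have h1 : ζ⁻¹ ^ (m + 1) * ζ = ζ⁻¹ ^ m := by
          rw [pow_succ, mul_assoc, inv_mul_cancel₀ h0, mul_one]
        simp only [smul_sub, smul_smul, h1]
        rw [pow_succ, mul_assoc]
    rw [key, hn, map_zero, smul_zero]
  have hσs : σ s = ζ • s := by
    have h1 (x : g) : ⁅ζ • s - σ s, σ x⁆ = 0 := by
      refine maxGenEigenspace_induction (p := fun x ↦ ⁅ζ • s - σ s, σ x⁆ = 0) (ad K g (e + x₀)) x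
        (fun μ x hx ↦ ?_) fun x x' h h' ↦ by rw [map_add, lie_add, h, h', add_zero]
      rw [sub_lie, ← p.rot_lie h0, hs μ x hx, smul_lie, hs _ _ (hgrade hx), smul_smul, map_smul,
        mul_inv_cancel_left₀ h0, sub_self]
    have h2 : ζ • s - σ s ∈ LieAlgebra.center K g := by
      rw [LieModule.mem_maxTrivSubmodule]
      intro x
      obtain ⟨x, rfl⟩ := p.rot_surjective hζ x
      rw [← lie_skew, h1, neg_zero]
    rw [center_eq_bot, LieSubmodule.mem_bot] at h2
    exact (sub_eq_zero.1 h2).symm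
  have hzs : ⁅e + x₀, s⁆ = 0 := by
    rw [← lie_skew, hs 0 _ (self_mem_grade_zero _), zero_smul, neg_zero]
  obtain ⟨c, hc⟩ := p.exists_eq_smul_of_lie_eq_zero hx hzs fun k hk ↦ by
    by_cases hkM : M < k
    · exact p.proj_eq_zero (.inr hkM) s
    refine p.proj_eq_zero_of_rot_eq hζ (m := 1) (by rw [zpow_one]; exact hσs) fun hd ↦ ?_
    have := Int.le_of_dvd (by omega) hd
    omega
  have hc0 : c ≠ 0 := by
    rintro rfl
    refine p.not_isNilpotent_ad_add hx hx0 ?_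
    obtain ⟨n, hn⟩ : ∃ n : ℕ,
        (ad K g (e + x₀)).maxGenEigenspace 0 = (ad K g (e + x₀)).genEigenspace 0 n :=
      ⟨_, maxGenEigenspace_eq ..⟩
    refine ⟨n, LinearMap.ext fun x ↦ ?_⟩
    have : x ∈ (ad K g (e + x₀)).maxGenEigenspace 0 := by
      refine maxGenEigenspace_induction
        (p := fun x ↦ x ∈ (ad K g (e + x₀)).maxGenEigenspace 0) (ad K g (e + x₀)) x
        (fun μ x hx ↦ ?_) fun x x' h h' ↦ add_mem h h'
      by_cases hμ : μ = 0
      · rwa [← hμ]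
      · have := hs μ x hx
        rw [hc, zero_smul, zero_lie, eq_comm, smul_eq_zero] at this
        rw [this.resolve_left hμ]
        exact zero_mem _
    rw [hn] at this
    simpa using this
  intro μ x hxμ
  have h1 := hs μ x hxμ
  rw [hc, smul_lie] at h1
  have h2 : ⁅e + x₀, x⁆ = (c⁻¹ * μ) • x := by
    rw [mul_smul, ← h1, smul_smul, inv_mul_cancel₀ hc0, one_smul]
  by_cases h : μ = c⁻¹ * μ
  · rw [h2, ← h]
  · have : x = 0 := by
      rw [← genProj_of_mem hxμ]
      exact genProj_of_mem_of_ne (mem_grade_of_lie_eq h2) h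
    simp [this]

theorem finrank_eq [H.IsCartanSubalgebra] : finrank K g = finrank K H * (M + 2) := by
  obtain ⟨x₀, hx, hx0⟩ : ∃ x₀ ∈ grade K a ((2 * -M : ℤ) : K), x₀ ≠ 0 := by
    have := grade_neg_ne_bot p.ne_bot
    rw [← Int.cast_neg, ← mul_neg] at this
    exact (Submodule.ne_bot_iff _).1 this
  have hdiag := p.isAdDiagonalizable_add hx hx0
  set z := e + x₀ with hz
  obtain ⟨ζ, hζ⟩ := HasEnoughRootsOfUnity.exists_primitiveRoot K (M + 1)
  have h0 : ζ ≠ 0 := hζ.ne_zero (by omega)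
  have hzr : rot a M ζ z = ζ • z := p.rot_add hζ hx
  have hker : finrank K (LinearMap.ker (ad K g z)) = finrank K H := by
    refine le_antisymm (p.finrank_ker_le hx) ?_
    obtain ⟨H', _, hzH'⟩ := hdiag.exists_isCartanSubalgebra
    rw [finrank_cartan_eq H H']
    exact Submodule.finrank_mono (s := H'.toSubmodule) fun w hw ↦ by
      simpa using lie_eq_zero_of_mem_cartan hzH' hw
  set W := LinearMap.range (ad K g z)
  have hrange : finrank K W = (M + 1) * finrank K H := by
    have hσW : ∀ w ∈ W, rot a M ζ w ∈ W := by
      rintro _ ⟨w, rfl⟩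
      rw [ad_apply, p.rot_lie h0, hzr, smul_lie]
      exact W.smul_mem _ ⟨_, rfl⟩
    have hFW : ∀ w ∈ W, ad K g z w ∈ W := fun w _ ↦ ⟨w, rfl⟩
    rw [finrank_eq_mul_finrank_eigenspace_one (n := M + 1) (by omega) hζ
      (σ := (rot a M ζ).restrict hσW) (F := (ad K g z).restrict hFW)]
    · congr 1
      have : Module.End.eigenspace ((rot a M ζ).restrict hσW) 1 =
        H.toSubmodule.comap W.subtype := by
        ext w
        rw [mem_eigenspace_iff, one_smul, Submodule.mem_comap, LieSubalgebra.mem_toSubmodule,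
          Submodule.subtype_apply, ← p.mem_cartan_iff hζ, Subtype.ext_iff]
        rfl
      rw [this]
      exact (Submodule.comapSubtypeEquivOfLe (p.cartan_le_range hx)).finrank_eq
    · rw [Module.End.pow_restrict]
      ext w
      simp [p.rot_pow hζ.pow_eq_one]
    · rw [← LinearMap.ker_eq_bot, LinearMap.ker_eq_bot']
      rintro ⟨_, w, rfl⟩ hw
      replace hw : ⁅z, ⁅z, w⁆⁆ = 0 := congrArg Subtype.val hw
      refine Subtype.ext ?_
      have : w ∈ grade K z 0 := (mem_maxGenEigenspace _ _ _).2 ⟨2, by simpa [pow_two] using hw⟩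
      simpa using hdiag 0 w this
    · ext w
      simp [p.rot_lie h0, hzr]
  have := (ad K g z).finrank_range_add_finrank_ker
  rw [hker, hrange] at this
  linarith

end LieAlgebra.IsPrincipalGrading

namespace LieAlgebra

open Module IsKilling

variable {K g : Type*} [Field K] [CharZero K] [IsAlgClosed K] [LieRing g] [LieAlgebra K g]
  [FiniteDimensional K g]

section

variable [IsKilling K g] {H : LieSubalgebra K g} [H.IsCartanSubalgebra] (b : (rootSystem H).Base)
  {s : H} {n : H.root → ℕ} (hn : ∀ i ∈ b.support, i.1 s = n i)

include hn in
lemma exists_height_eq_and_apply_eq (i : H.root) : ∃ f : H.root → ℕ,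
    (b.height i = ∑ j ∈ b.support, f j ∧ i.1 s = ((∑ j ∈ b.support, f j * n j : ℕ) : K)) ∨
    (b.height i = -∑ j ∈ b.support, f j ∧ i.1 s = -((∑ j ∈ b.support, f j * n j : ℕ) : K)) := by
  obtain ⟨f, -, h⟩ := b.exists_root_eq_sum_nat_or_neg i
  refine ⟨f, h.imp (fun h ↦ ⟨?_, ?_⟩) fun h ↦ ⟨?_, ?_⟩⟩
  · rw [b.height_eq_sum (i := i) (f := fun j ↦ (f j : ℤ)) (by simp [h]), Nat.cast_sum]
  · rw [apply_eq_sum_of_root_eq b h, Nat.cast_sum]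
    exact Finset.sum_congr rfl fun j hj ↦ by rw [hn j hj, Nat.cast_mul]
  · rw [b.height_eq_sum (i := i) (f := fun j ↦ -(f j : ℤ)) (by simp [h]), Finset.sum_neg_distrib,
      Nat.cast_sum]
  · have := LinearMap.congr_fun h s
    have h2 : i.1 s = -∑ j ∈ b.support, f j * j.1 s := by
      simpa [LinearMap.sum_apply] using this
    rw [h2, Nat.cast_sum]
    exact congrArg _ <| Finset.sum_congr rfl fun j hj ↦ by rw [hn j hj, Nat.cast_mul]

lemma rootSpace_le_grade (i : H.root) (s : H) :
    (rootSpace H i.1).toSubmodule ≤ grade K (s : g) (i.1 s) :=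
  fun _ hx ↦ mem_grade_of_lie_eq (lie_eq_smul_of_mem_rootSpace hx s)

lemma grade_apply_ne_bot (i : H.root) (s : H) : grade K (s : g) (i.1 s) ≠ ⊥ := by
  obtain ⟨e, -, he, -, he0, -⟩ := exists_rootVectors H
  exact (Submodule.ne_bot_iff _).2 ⟨e i, rootSpace_le_grade i s (he i), he0 i⟩

variable {N y a : g} (t : IsHalfTriple K N y a) (hs : ∀ μ, grade K (s : g) μ = grade K a μ)
include hn t hs

/-- The labels of the weighted Dynkin diagram of a nilpotent element are at most `2`. -/
lemma IsHalfTriple.le_two_of_mem_support {i : H.root} (hi : i ∈ b.support) : n i ≤ 2 := by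
  by_contra! h3
  obtain ⟨_, f, _, hf, _, hef⟩ := exists_rootVectors H
  have hfi : ⁅(s : g), f i⁆ = ((-n i : ℤ) : K) • f i := by
    refine (lie_eq_smul_of_mem_rootSpace (hf i) s).trans ?_
    simp [hn i hi]
  have hNf : ⁅N, f i⁆ = 0 := by
    suffices N ∈ LinearMap.ker (ad K g (f i)) by
      rw [← lie_skew, neg_eq_zero]
      simpa using this
    have hN := t.mem_grade
    rw [← hs] at hN
    refine mem_of_mem_grade_of_forall_rootSpace_le s (fun h0 ↦ by simp at h0)
      (fun α hα h2 x hx ↦ ?_) hN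
    rw [LinearMap.mem_ker, ad_apply, ← lie_skew, neg_eq_zero]
    by_contra hne
    let j : H.root := ⟨α, by simpa [LieSubalgebra.root] using hα⟩
    have hj2 : j.1 s = ((2 : ℕ) : K) := by simpa using h2
    have hij : j ≠ i := by
      rintro rfl
      rw [hn _ hi] at hj2
      have : n j = 2 := by exact_mod_cast hj2
      omega
    obtain ⟨k, hk⟩ := exists_root_eq_sub_of_lie_ne_zero hij hx (hf i) hne
    have hkh := b.height_sub hk
    rw [b.height_one_of_mem_support hi] at hkh
    have hks : k.1 s = ((2 - n i : ℤ) : K) := by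
      have : k.1 s = j.1 s - i.1 s := by simpa using LinearMap.congr_fun hk s
      rw [this, hj2, hn i hi]
      push_cast; rfl
    have hjpos : 0 < b.height j := by
      obtain ⟨c, ⟨hc, -⟩ | ⟨-, hc⟩⟩ := exists_height_eq_and_apply_eq b hn j
      · have := b.height_ne_zero j
        have : 0 ≤ ((∑ j ∈ b.support, c j : ℕ) : ℤ) := by positivity
        omega
      · rw [hj2, eq_neg_iff_add_eq_zero] at hc
        norm_cast at hc
        omega
    have hk0 := b.height_ne_zero k
    obtain ⟨c, ⟨-, hc⟩ | ⟨hc, -⟩⟩ := exists_height_eq_and_apply_eq b hn k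
    · rw [hks] at hc
      have : (2 - n i : ℤ) = (∑ j ∈ b.support, c j * n j : ℕ) := by exact_mod_cast hc
      omega
    · have : 0 ≤ ((∑ j ∈ b.support, c j : ℕ) : ℤ) := by positivity
      omega
  have := t.eq_zero_of_lie_eq_zero_of_mem_grade (m := -n i) (by omega)
    (by rw [← hs]; exact mem_grade_of_lie_eq hfi) hNf
  refine coroot_coe_ne_zero i ?_
  rw [← hef, this, lie_zero]

omit hn in
/-- A nilpotent element with a centralizer of dimension equal to the rank is even. -/
lemma IsHalfTriple.apply_ne_of_finrank_ker_eq
    (h : finrank K (LinearMap.ker (ad K g N)) = finrank K H) (i : H.root) :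
    i.1 s ≠ 0 ∧ i.1 s ≠ 1 := by
  rw [t.finrank_ker_ad, ← hs, ← hs] at h
  have hle : H.toSubmodule ≤ grade K (s : g) 0 := fun x hx ↦ mem_grade_zero_of_mem_cartan s.2 hx
  have h1 : finrank K H ≤ finrank K (grade K (s : g) 0) := Submodule.finrank_mono hle
  refine ⟨fun h0 ↦ ?_, fun h0 ↦ ?_⟩
  · have heq : H.toSubmodule = grade K (s : g) 0 :=
      Submodule.eq_of_le_of_finrank_le hle (by change _ ≤ finrank K H; omega)
    obtain ⟨e, -, he, -, he0, -⟩ := exists_rootVectors H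
    have heH : e i ∈ H := by
      have := rootSpace_le_grade i s (he i)
      rwa [h0, ← heq] at this
    have h2 : ⁅(coroot i.1 : g), e i⁆ = _ := lie_eq_smul_of_mem_rootSpace (he i) (coroot i.1)
    rw [lie_eq_zero_of_mem_cartan (coroot i.1).2 heH,
      root_apply_coroot (H.isNonZero_coe_root i)] at h2
    exact he0 i ((smul_eq_zero.1 h2.symm).resolve_left two_ne_zero)
  · have h2 := grade_apply_ne_bot i s
    rw [h0] at h2
    have h3 := Submodule.one_le_finrank_iff.2 (grade_neg_ne_bot h2)
    omega

end

variable [IsSimple K g] {H : LieSubalgebra K g} [H.IsCartanSubalgebra] (b : (rootSystem H).Base)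
  {s : H} {n : H.root → ℕ} (hn : ∀ i ∈ b.support, i.1 s = n i)
  {N y a : g} (t : IsHalfTriple K N y a) (hs : ∀ μ, grade K (s : g) μ = grade K a μ)
include hn t hs

lemma IsHalfTriple.pow_ne_zero_iff {θ : H.root} {M : ℕ} (hθ : b.height θ = M)
    (hmax : ∀ i, b.height i ≤ M) :
    ad K g N ^ (2 * M) ≠ 0 ↔ finrank K (LinearMap.ker (ad K g N)) = finrank K H := by
  have hle {i : H.root} (hi : i ∈ b.support) := t.le_two_of_mem_support b hn hs hi
  have hM : 1 ≤ M := by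
    have := (⟨θ⟩ : Nonempty H.root)
    obtain ⟨i, hi⟩ := b.support_nonempty
    have := b.height_one_of_mem_support hi
    have := hmax i
    omega
  constructor
  · intro h
    obtain ⟨m, hm, hne⟩ := t.exists_grade_ne_bot_of_pow_ne_zero h
    rw [← hs] at hne
    obtain ⟨i, hi⟩ : ∃ i : H.root, i.1 s = m := by
      by_contra! hc
      refine hne ((Submodule.eq_bot_iff _).2 fun x hx ↦ ?_)
      refine (Submodule.mem_bot K).1 <| mem_of_mem_grade_of_forall_rootSpace_le s
        (fun h0 ↦ ?_) (fun α hα h0 ↦ ?_) hx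
      · have : m = 0 := by exact_mod_cast h0
        omega
      · exact absurd h0 (hc ⟨α, by simpa [LieSubalgebra.root] using hα⟩)
    have hlarge (f : H.root → ℕ) : ∑ j ∈ b.support, f j * n j ≤ 2 * ∑ j ∈ b.support, f j := by
      rw [Finset.mul_sum]
      exact Finset.sum_le_sum fun j hj ↦ by nlinarith [hle hj]
    have hiM : b.height i = M := by
      obtain ⟨f, ⟨h1, h2⟩ | ⟨-, h2⟩⟩ := exists_height_eq_and_apply_eq b hn i
      · rw [hi] at h2
        have h3 : m = ∑ j ∈ b.support, f j * n j := by exact_mod_cast h2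
        have h4 := hlarge f
        have h5 := hmax i
        rw [h1] at h5 ⊢
        norm_cast at h5 ⊢
        omega
      · rw [hi, eq_neg_iff_add_eq_zero] at h2
        norm_cast at h2
        omega
    obtain ⟨f, hf, hroot⟩ := b.exists_root_eq_sum_of_forall_height_le (i := i) (hiM ▸ hmax)
    have h1 : (M : ℤ) = ∑ j ∈ b.support, (f j : ℤ) := by
      rw [← hiM]
      exact b.height_eq_sum (i := i) (f := fun j ↦ (f j : ℤ)) (by simp [hroot])
    have h2 : m = ∑ j ∈ b.support, f j * n j := by
      have := apply_eq_sum_of_root_eq b hroot s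
      rw [hi, Finset.sum_congr rfl fun j hj ↦ by rw [hn j hj]] at this
      exact_mod_cast this
    have h3 : M = ∑ j ∈ b.support, f j := by exact_mod_cast h1
    have h4 : ∑ j ∈ b.support, f j * n j = ∑ j ∈ b.support, f j * 2 := by
      refine le_antisymm ((hlarge f).trans_eq ?_) ?_
      · rw [mul_comm, Finset.sum_mul]
      · rw [← Finset.sum_mul, ← h3, ← h2]
        omega
    have h5 (j) (hj : j ∈ b.support) : j.1 s = 2 := by
      have := (Finset.sum_eq_sum_iff_of_le fun j hj ↦ Nat.mul_le_mul_left (f j) (hle hj)).1 h4 j hj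
      have := Nat.eq_of_mul_eq_mul_left (hf j hj) this
      rw [hn j hj, this, Nat.cast_ofNat]
    rw [t.finrank_ker_ad, ← hs, ← hs, grade_zero_eq_cartan b h5]
    have : grade K (s : g) (-1) = ⊥ := by
      by_contra h0
      rcases exists_height_eq_of_grade_ne_bot b h5 h0 with h | ⟨j, h⟩
      · simp at h
      · have : -1 = 2 * b.height j := by exact_mod_cast h
        omega
    rw [this, finrank_bot, add_zero]
    rfl
  · intro h
    have h2 (i) (hi : i ∈ b.support) : i.1 s = 2 := by
      have h1 := t.apply_ne_of_finrank_ker_eq hs h i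
      rw [hn i hi] at h1 ⊢
      norm_cast at h1 ⊢
      have := hle hi
      omega
    have h3 := grade_apply_ne_bot θ s
    rw [apply_eq_two_mul_height b h2, hθ, hs] at h3
    exact t.pow_ne_zero_of_grade_ne_bot le_rfl (by exact_mod_cast h3)

end LieAlgebra

open Module LieAlgebra IsKilling

/-! STATEMENT 12: Let `ĝ` be a simple Lie algebra with Coxeter number `h` (so that
`dim ĝ = r·(h+1)` where `r` is the rank).  A nilpotent element `N ∈ ĝ` satisfies
`ad(N)^{2h−2} ≠ 0` if and only if `N` is regular nilpotent (its centralizer has dimension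
equal to the rank).  Equivalently, the regular nilpotent class is the unique nilpotent
class whose adjoint action on `ĝ` has a Jordan block of size `≥ 2h−1`. -/

theorem ad_pow_two_coxeter_sub_two_ne_zero_iff_regular_nilpotent
    {K : Type*} [Field K] [IsAlgClosed K] [CharZero K]
    {g : Type*} [LieRing g] [LieAlgebra K g] [FiniteDimensional K g]
    [LieAlgebra.IsSimple K g]
    (H : LieSubalgebra K g) [H.IsCartanSubalgebra]
    -- h is the Coxeter number: dim g = rank · (h + 1)
    (h : ℕ) (hh : 2 ≤ h)
    (hcox : Module.finrank K g = Module.finrank K ↥H * (h + 1))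
    (N : g) (hN : IsNilpotent (LieAlgebra.ad K g N)) :
    (LieAlgebra.ad K g N) ^ (2 * h - 2) ≠ 0 ↔
      Module.finrank K ↥(LinearMap.ker (LieAlgebra.ad K g N)) = Module.finrank K ↥H := by
  obtain ⟨y, a, t⟩ := exists_isHalfTriple hN
  obtain ⟨s, hs⟩ := exists_forall_mem_grade_lie_eq_smul (K := K) a
  obtain ⟨H', _, hsH⟩ := (isAdDiagonalizable_of_forall_lie_eq_smul hs).exists_isCartanSubalgebra
  lift s to H' using hsH
  have hgr := grade_eq_of_forall_lie_eq_smul hs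
  obtain ⟨b, hb⟩ := exists_base_forall_natCast s fun i ↦
    t.exists_intCast_of_grade_ne_bot (hgr _ ▸ grade_apply_ne_bot i s)
  choose! n hn using hb
  have hne : Nonempty H'.root := by
    by_contra! hempty
    have h1 := RootPairing.IsRootSystem.span_root_eq_top (P := rootSystem H')
    rw [Set.range_eq_empty, Submodule.span_empty] at h1
    have : Nontrivial (Dual K H') := RootPairing.IsIrreducible.nontrivial (P := rootSystem H')
    exact bot_ne_top h1
  obtain ⟨θ, hθ⟩ := Finite.exists_max b.height
  obtain ⟨i, hi⟩ := b.support_nonempty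
  have h1 := b.height_one_of_mem_support hi
  have h2 := hθ i
  obtain ⟨M, hM⟩ : ∃ M : ℕ, b.height θ = M := ⟨_, (Int.toNat_of_nonneg (by omega)).symm⟩
  obtain ⟨e, y', a', p⟩ := exists_isPrincipalGrading b hM (hM ▸ hθ)
  have hr : 0 < finrank K H' := by
    have : Nontrivial H' := ⟨coroot θ.1, 0, fun h0 ↦ coroot_coe_ne_zero θ (congrArg Subtype.val h0)⟩
    exact finrank_pos
  rw [finrank_cartan_eq H H'] at hcox ⊢
  have h3 := Nat.eq_of_mul_eq_mul_left hr (hcox.symm.trans p.finrank_eq)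
  rw [show 2 * h - 2 = 2 * M by omega]
  exact t.pow_ne_zero_iff b hn hgr hM (hM ▸ hθ)
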